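/- arXiv:1003.5639 — 4 statements merged into one kernel-verified Lean document; each statement's English description precedes it below -/
import Mathlib

section
/- Let (K,v) be a henselian valued field of characteristic p>0 and let (K^c,v) be its completion with respect to the valuation topology. Then (K,v) is a separably defectless field (every finite separable extension of (K,v), with the unique extension of v, is defectless) if and only if (K^c,v) is a defectless field (every finite extension of (K^c,v), with the unique extension of v, is defectless). -/
open scoped Classical

noncomputable section

namespace ValuedDefect

universe u v

variable {K : Type u} {L : Type v} [Field K] [Field L]

/-- The ramification index `(vL : vK)`: the index of the image of `Kˣ` in the
value group `Lˣ / Bˣ` of the valuation subring `B` of `L`. -/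
def ramIndex (K : Type u) {L : Type v} [Field K] [Field L] [Algebra K L]
    (B : ValuationSubring L) : ℕ :=
  (Subgroup.map (QuotientGroup.mk' B.unitGroup)
    (MonoidHom.range (Units.map (algebraMap K L).toMonoidHom))).index

/-- The ring homomorphism `A →+* B` induced by `algebraMap K L` when `B` lies above `A`. -/
def valHom [Algebra K L] (A : ValuationSubring K) (B : ValuationSubring L)
    (h : B.comap (algebraMap K L) = A) : A →+* B where
  toFun x := ⟨algebraMap K L x, by
    have hx : (x : K) ∈ B.comap (algebraMap K L) := by rw [h]; exact x.2
    exact ValuationSubring.mem_comap.mp hx⟩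
  map_one' := Subtype.ext (by simp)
  map_mul' x y := Subtype.ext (by simp)
  map_zero' := Subtype.ext (by simp)
  map_add' x y := Subtype.ext (by simp)

theorem valHom_isLocalHom [Algebra K L] (A : ValuationSubring K) (B : ValuationSubring L)
    (h : B.comap (algebraMap K L) = A) : IsLocalHom (valHom A B h) := by
  constructor
  intro x hx
  rcases isUnit_iff_exists_inv.mp hx with ⟨y, hy⟩
  have hy' : algebraMap K L (x : K) * (y : L) = 1 := congrArg Subtype.val hy
  have hx0 : (x : K) ≠ 0 := by
    rintro h0
    rw [h0, map_zero, zero_mul] at hy'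
    exact zero_ne_one hy'
  have hyx : (y : L) = algebraMap K L ((x : K)⁻¹) := by
    rw [map_inv₀]
    exact eq_inv_of_mul_eq_one_right hy'
  have hmem : ((x : K)⁻¹ : K) ∈ A := by
    have hB : algebraMap K L ((x : K)⁻¹) ∈ B := hyx ▸ y.2
    have := ValuationSubring.mem_comap.mpr hB
    rwa [h] at this
  refine isUnit_iff_exists_inv.mpr ⟨⟨(x : K)⁻¹, hmem⟩, Subtype.ext ?_⟩
  exact mul_inv_cancel₀ hx0

/-- The residue degree `[Lv : Kv]` of an extension of valuation subrings. -/
def residueDegree [Algebra K L] (A : ValuationSubring K) (B : ValuationSubring L) : ℕ :=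
  if h : B.comap (algebraMap K L) = A then
    letI := valHom_isLocalHom A B h
    letI := (IsLocalRing.ResidueField.map (valHom A B h)).toAlgebra
    Module.finrank (IsLocalRing.ResidueField A) (IsLocalRing.ResidueField B)
  else 0

/-- A finite extension of valued fields (with unique extension of the valuation) is
defectless if `[L : K] = (vL : vK) · [Lv : Kv]`. -/
def IsDefectless [Algebra K L] (A : ValuationSubring K) (B : ValuationSubring L) : Prop :=
  Module.finrank K L = ramIndex K B * residueDegree A B

/-- An extension of valued fields is immediate if `vL = vK` and `Lv = Kv`. -/
def IsImmediate (K : Type u) {L : Type v} [Field K] [Field L] [Algebra K L]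
    (B : ValuationSubring L) : Prop :=
  (∀ x : L, x ≠ 0 → ∃ c : K, B.valuation x = B.valuation (algebraMap K L c)) ∧
  ∀ x : L, B.valuation x ≤ 1 → ∃ c : K, B.valuation (x - algebraMap K L c) < 1

/-- A valued field is a defectless field if every finite extension is defectless. -/
def IsDefectlessField {K : Type u} [Field K] (A : ValuationSubring K) : Prop :=
  ∀ (L : Type u) [Field L] [Algebra K L], FiniteDimensional K L →
    ∀ B : ValuationSubring L, B.comap (algebraMap K L) = A → IsDefectless A B

/-- A valued field is a separably defectless field if every finite separable extension is
defectless. -/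
def IsSepDefectlessField {K : Type u} [Field K] (A : ValuationSubring K) : Prop :=
  ∀ (L : Type u) [Field L] [Algebra K L], FiniteDimensional K L → Algebra.IsSeparable K L →
    ∀ B : ValuationSubring L, B.comap (algebraMap K L) = A → IsDefectless A B

/-- A valued field is inseparably defectless if every finite purely inseparable extension is
defectless. -/
def IsInsepDefectless {K : Type u} [Field K] (A : ValuationSubring K) : Prop :=
  ∀ (L : Type u) [Field L] [Algebra K L], FiniteDimensional K L → IsPurelyInseparable K L →
    ∀ B : ValuationSubring L, B.comap (algebraMap K L) = A → IsDefectless A B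

/-- A valued field is algebraically maximal if it admits no proper immediate algebraic
extension. -/
def IsAlgMaximal {K : Type u} [Field K] (A : ValuationSubring K) : Prop :=
  ∀ (L : Type u) [Field L] [Algebra K L], Algebra.IsAlgebraic K L →
    ∀ B : ValuationSubring L, B.comap (algebraMap K L) = A → IsImmediate K B →
      Function.Surjective (algebraMap K L)

/-- A valued field is separable-algebraically maximal if it admits no proper immediate
separable-algebraic extension. -/
def IsSepAlgMaximal {K : Type u} [Field K] (A : ValuationSubring K) : Prop :=
  ∀ (L : Type u) [Field L] [Algebra K L], Algebra.IsAlgebraic K L → Algebra.IsSeparable K L →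
    ∀ B : ValuationSubring L, B.comap (algebraMap K L) = A → IsImmediate K B →
      Function.Surjective (algebraMap K L)

/-- `(K,v)` is `K`-extremal with respect to `f` if the set `{v f(a) : a ∈ K}` has a maximum
(in the multiplicative convention: a minimum). -/
def KExtremal (A : ValuationSubring K) (f : Polynomial K) : Prop :=
  ∃ a : K, ∀ b : K, A.valuation (f.eval a) ≤ A.valuation (f.eval b)

/-- `(K,v)` is `O`-extremal with respect to `f` if the set `{v f(a) : a ∈ O}` has a maximum. -/
def OExtremal (A : ValuationSubring K) (f : Polynomial K) : Prop :=
  ∃ a : A, ∀ b : A, A.valuation (f.eval (a : K)) ≤ A.valuation (f.eval (b : K))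

/-- `K`-extremality for multivariable polynomials. -/
def KExtremalMv (A : ValuationSubring K) {n : ℕ} (f : MvPolynomial (Fin n) K) : Prop :=
  ∃ a : Fin n → K, ∀ b : Fin n → K,
    A.valuation (MvPolynomial.eval a f) ≤ A.valuation (MvPolynomial.eval b f)

/-- A `p`-polynomial: an additive polynomial plus a constant. -/
def IsPPolynomial (p : ℕ) (f : Polynomial K) : Prop :=
  ∃ (c : K) (m : ℕ) (co : ℕ → K),
    f = Polynomial.C c + ∑ i ∈ Finset.range (m + 1), Polynomial.C (co i) * Polynomial.X ^ p ^ i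

/-- A field of characteristic `p > 0` is Artin-Schreier closed if every polynomial
`X^p - X - a` has a root. -/
def ASClosed (K : Type*) [Field K] (p : ℕ) : Prop :=
  ∀ a : K, ∃ x : K, x ^ p - x = a

/-- The subfield `K^p` of `p`-th powers of a field of characteristic `p`. -/
def pPowerSubfield (K : Type*) [Field K] (p : ℕ) (hp : p.Prime) [CharP K p] : Subfield K :=
  haveI : Fact p.Prime := ⟨hp⟩
  (frobenius K p).fieldRange

/-- The field `K^{1/p}` of `p`-th roots of `K` inside a purely inseparable extension `P`. -/
def pthRootField (K : Type u) (P : Type v) [Field K] [Field P] [Algebra K P]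
    (p : ℕ) (hp : p.Prime) [CharP K p] : IntermediateField K P :=
  haveI : Fact p.Prime := ⟨hp⟩
  haveI : CharP P p := charP_of_injective_algebraMap (algebraMap K P).injective p
  { carrier := {x : P | x ^ p ∈ (algebraMap K P).range}
    mul_mem' := fun {a b} ha hb => by
      rcases ha with ⟨c, hc⟩
      rcases hb with ⟨d, hd⟩
      exact ⟨c * d, by rw [map_mul, hc, hd, mul_pow]⟩
    one_mem' := ⟨1, by rw [map_one, one_pow]⟩
    add_mem' := fun {a b} ha hb => by
      rcases ha with ⟨c, hc⟩
      rcases hb with ⟨d, hd⟩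
      exact ⟨c + d, by rw [map_add, hc, hd, add_pow_char]⟩
    zero_mem' := ⟨0, by rw [map_zero, zero_pow hp.ne_zero]⟩
    algebraMap_mem' := fun r => ⟨r ^ p, by rw [map_pow]⟩
    inv_mem' := fun x hx => by
      rcases hx with ⟨c, hc⟩
      exact ⟨c⁻¹, by rw [map_inv₀, hc, inv_pow]⟩ }

/-- A (possibly infinite) algebraic extension of valued fields is defectless if every finite
subextension is defectless. -/
def IsDefectlessAlgExt {K : Type u} {L : Type v} [Field K] [Field L] [Algebra K L]
    (A : ValuationSubring K) (B : ValuationSubring L) : Prop :=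
  ∀ E : IntermediateField K L, FiniteDimensional K E →
    IsDefectless A (B.comap (algebraMap E L))

/-- A finite family `b` in a valued field extension of `F` is valuation independent if all its
members are nonzero and every term of an `F`-linear combination is bounded by the whole sum. -/
def ValIndep (F : Type*) {M Γ ι : Type*} [Field F] [Field M] [Algebra F M]
    [LinearOrderedCommGroupWithZero Γ] [Fintype ι] (w : Valuation M Γ) (b : ι → M) : Prop :=
  (∀ i, b i ≠ 0) ∧ ∀ (c : ι → F) (i : ι), w (c i • b i) ≤ w (∑ j, c j • b j)

section ValIndep

variable {F M N Γ Γ' ι : Type*} [Field F] [Field M] [Field N] [Algebra F M] [Algebra F N]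
  [LinearOrderedCommGroupWithZero Γ] [LinearOrderedCommGroupWithZero Γ'] [Fintype ι]

theorem ValIndep.linearIndependent {w : Valuation M Γ} {b : ι → M} (h : ValIndep F w b) :
    LinearIndependent F b := by
  rw [Fintype.linearIndependent_iff]
  intro g hg i
  have := h.2 g i
  rw [hg, map_zero, le_zero_iff, Valuation.zero_iff] at this
  exact (smul_eq_zero.mp this).resolve_right (h.1 i)

/-- Valuation independence transfers along a map preserving the order of values. -/
theorem ValIndep.of_le_iff_le {w : Valuation M Γ} {w' : Valuation N Γ'} {b : ι → M}
    (h : ValIndep F w b) (φ : M →ₗ[F] N) (hφ : ∀ x y, w x ≤ w y → w' (φ x) ≤ w' (φ y))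
    (hinj : Function.Injective φ) : ValIndep F w' (fun i ↦ φ (b i)) := by
  refine ⟨fun i hi ↦ h.1 i (hinj (hi.trans (map_zero φ).symm)), fun c i ↦ ?_⟩
  have := hφ _ _ (h.2 c i)
  simpa [map_sum] using this

theorem ValIndep.reindex {κ : Type*} [Fintype κ] {w : Valuation M Γ} {b : ι → M}
    (h : ValIndep F w b) (e : κ ≃ ι) : ValIndep F w (b ∘ e) := by
  refine ⟨fun i ↦ h.1 _, fun c i ↦ ?_⟩
  have := h.2 (c ∘ e.symm) (e i)
  rw [← e.sum_comp] at this
  simpa using this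

/-- A family close to a valuation independent family is valuation independent. -/
theorem ValIndep.of_sub_lt {w : Valuation M Γ} {b b' : ι → M} (h : ValIndep F w b)
    (hb : ∀ i, w (b' i - b i) < w (b i)) : ValIndep F w b' := by
  have hval : ∀ i, w (b' i) = w (b i) := fun i ↦ by
    have := w.map_add_eq_of_lt_right (hb i)
    rwa [sub_add_cancel] at this
  refine ⟨fun i hi ↦ ?_, fun c i ↦ ?_⟩
  · have := hval i
    rw [hi, map_zero, eq_comm, Valuation.zero_iff] at this
    exact h.1 i this
  · have key : w (∑ j, c j • b' j) = w (∑ j, c j • b j) := by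
      have hsplit : ∑ j, c j • b' j = ∑ j, c j • (b' j - b j) + ∑ j, c j • b j := by
        rw [← Finset.sum_add_distrib]
        exact Finset.sum_congr rfl fun j _ ↦ by rw [← smul_add, sub_add_cancel]
      by_cases hc : c = 0
      · simp [hc]
      · have hs : w (∑ j, c j • b j) ≠ 0 := fun h0 ↦ hc <| funext <|
          Fintype.linearIndependent_iff.mp h.linearIndependent c ((Valuation.zero_iff _).mp h0)
        rw [hsplit]
        refine w.map_add_eq_of_lt_right (w.map_sum_lt hs fun j _ ↦ ?_)
        by_cases hj : c j = 0
        · simpa [hj, zero_lt_iff] using hs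
        · refine lt_of_lt_of_le ?_ (h.2 c j)
          rw [Algebra.smul_def, Algebra.smul_def, map_mul, map_mul]
          exact mul_lt_mul_of_pos_left (hb j) (zero_lt_iff.mpr (by simpa using hj))
    rw [key]
    refine le_trans (le_of_eq ?_) (h.2 c i)
    rw [Algebra.smul_def, Algebra.smul_def, map_mul, map_mul, hval]

end ValIndep

section Residue

variable {F M : Type*} [Field F] [Field M] [Algebra F M] {A : ValuationSubring F}
  {B : ValuationSubring M}

theorem valuation_algebraMap_le_one_iff (hAB : B.comap (algebraMap F M) = A) (a : F) :
    B.valuation (algebraMap F M a) ≤ 1 ↔ a ∈ A := by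
  rw [ValuationSubring.valuation_le_one_iff, ← hAB, ValuationSubring.mem_comap]

theorem isEquiv_comap_valuation (hAB : B.comap (algebraMap F M) = A) :
    (B.valuation.comap (algebraMap F M)).IsEquiv A.valuation := by
  rw [Valuation.isEquiv_iff_val_le_one]
  intro x
  rw [Valuation.comap_apply, valuation_algebraMap_le_one_iff hAB,
    ValuationSubring.valuation_le_one_iff]

theorem valuation_algebraMap_lt_one_iff (hAB : B.comap (algebraMap F M) = A) (a : F) :
    B.valuation (algebraMap F M a) < 1 ↔ A.valuation a < 1 :=
  (Valuation.isEquiv_iff_val_lt_one.mp (isEquiv_comap_valuation hAB) (x := a))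

theorem exists_residue_family (hAB : B.comap (algebraMap F M) = A) (hf : residueDegree A B ≠ 0) :
    ∃ Y : Fin (residueDegree A B) → B, ∀ a : Fin (residueDegree A B) → A,
      B.valuation (∑ j, algebraMap F M (a j) * (Y j : M)) < 1 → ∀ j, A.valuation (a j : F) < 1 := by
  revert hf
  unfold residueDegree
  rw [dif_pos hAB]
  let _ := valHom_isLocalHom A B hAB
  let _ := (IsLocalRing.ResidueField.map (valHom A B hAB)).toAlgebra
  intro hf
  have := Module.finite_of_finrank_pos (Nat.pos_of_ne_zero hf)
  let y := Module.finBasis (IsLocalRing.ResidueField A) (IsLocalRing.ResidueField B)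
  choose Y hY using fun j ↦ IsLocalRing.residue_surjective (R := B) (y j)
  refine ⟨Y, fun a ha j ↦ ?_⟩
  have hval : ((∑ j, valHom A B hAB (a j) * Y j : B) : M) =
      ∑ j, algebraMap F M (a j) * (Y j : M) := by
    push_cast
    rfl
  rw [← hval, ← ValuationSubring.valuation_lt_one_iff, ← IsLocalRing.residue_eq_zero_iff,
    map_sum] at ha
  rw [← ValuationSubring.valuation_lt_one_iff, ← IsLocalRing.residue_eq_zero_iff]
  refine Fintype.linearIndependent_iff.mp y.linearIndependent
    (fun j ↦ IsLocalRing.residue A (a j)) ?_ j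
  rw [← ha]
  refine Finset.sum_congr rfl fun j _ ↦ ?_
  rw [Algebra.smul_def, map_mul, hY]
  rfl

theorem residueDegree_eq_card {ι : Type*} [Fintype ι] (hAB : B.comap (algebraMap F M) = A)
    (Y : ι → B)
    (hind : ∀ a : ι → A, B.valuation (∑ j, algebraMap F M (a j) * (Y j : M)) < 1 →
      ∀ j, A.valuation (a j : F) < 1)
    (hspan : ∀ y : B, ∃ a : ι → A,
      B.valuation ((y : M) - ∑ j, algebraMap F M (a j) * (Y j : M)) < 1) :
    residueDegree A B = Fintype.card ι := by
  unfold residueDegree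
  rw [dif_pos hAB]
  let _ := valHom_isLocalHom A B hAB
  let _ := (IsLocalRing.ResidueField.map (valHom A B hAB)).toAlgebra
  have hval (a : ι → A) : ((∑ j, valHom A B hAB (a j) * Y j : B) : M) =
      ∑ j, algebraMap F M (a j) * (Y j : M) := by
    push_cast
    rfl
  have hres (a : ι → A) : ∑ j, (IsLocalRing.residue A (a j)) • IsLocalRing.residue B (Y j) =
      IsLocalRing.residue B (∑ j, valHom A B hAB (a j) * Y j) := by
    rw [map_sum]
    refine Finset.sum_congr rfl fun j _ ↦ ?_
    rw [Algebra.smul_def, map_mul]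
    rfl
  have hli : LinearIndependent (IsLocalRing.ResidueField A)
      (fun j ↦ IsLocalRing.residue B (Y j)) := by
    rw [Fintype.linearIndependent_iff]
    intro g hg j
    choose a ha using fun j ↦ IsLocalRing.residue_surjective (R := A) (g j)
    simp_rw [← ha] at hg
    rw [hres, IsLocalRing.residue_eq_zero_iff, ValuationSubring.valuation_lt_one_iff, hval] at hg
    rw [← ha, IsLocalRing.residue_eq_zero_iff, ValuationSubring.valuation_lt_one_iff]
    exact hind a hg j
  have hsp : ⊤ ≤ Submodule.span (IsLocalRing.ResidueField A)
      (Set.range fun j ↦ IsLocalRing.residue B (Y j)) := by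
    intro z _
    obtain ⟨y, rfl⟩ := IsLocalRing.residue_surjective (R := B) z
    obtain ⟨a, ha⟩ := hspan y
    have : IsLocalRing.residue B y =
        ∑ j, (IsLocalRing.residue A (a j)) • IsLocalRing.residue B (Y j) := by
      rw [← hval a] at ha
      rw [hres, ← sub_eq_zero, ← map_sub, IsLocalRing.residue_eq_zero_iff,
        ValuationSubring.valuation_lt_one_iff]
      exact ha
    rw [this]
    exact Submodule.sum_mem _ fun j _ ↦
      Submodule.smul_mem _ _ (Submodule.subset_span ⟨j, rfl⟩)
  exact Module.finrank_eq_card_basis (Module.Basis.mk hli hsp)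

end Residue

section Ramification

variable {F M : Type*} [Field F] [Field M] [Algebra F M]

/-- The units of `M` whose value is the value of an element of `F`. -/
def baseValueSubgroup (F : Type*) {M : Type*} [Field F] [Field M] [Algebra F M]
    (B : ValuationSubring M) : Subgroup Mˣ :=
  (Subgroup.map (QuotientGroup.mk' B.unitGroup)
    (MonoidHom.range (Units.map (algebraMap F M).toMonoidHom))).comap
      (QuotientGroup.mk' B.unitGroup)

theorem mem_baseValueSubgroup {B : ValuationSubring M} {x : Mˣ} :
    x ∈ baseValueSubgroup F B ↔ ∃ c : F, B.valuation (x : M) = B.valuation (algebraMap F M c) := by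
  unfold baseValueSubgroup
  rw [Subgroup.mem_comap, Subgroup.mem_map]
  constructor
  · rintro ⟨_, ⟨c, rfl⟩, hc⟩
    rw [QuotientGroup.mk'_apply, QuotientGroup.mk'_apply, QuotientGroup.eq,
      ValuationSubring.mem_unitGroup_iff] at hc
    refine ⟨c, ?_⟩
    have hc0 : B.valuation (algebraMap F M c) ≠ 0 := by simp
    simp only [Units.val_mul, map_mul, Units.val_inv_eq_inv_val, map_inv₀] at hc
    exact (inv_mul_eq_one₀ hc0).mp hc |>.symm
  · rintro ⟨c, hc⟩
    have hc0 : c ≠ 0 := by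
      rintro rfl
      simp at hc
    refine ⟨_, ⟨Units.mk0 c hc0, rfl⟩, ?_⟩
    rw [QuotientGroup.mk'_apply, QuotientGroup.mk'_apply, QuotientGroup.eq,
      ValuationSubring.mem_unitGroup_iff]
    have hc0' : B.valuation (algebraMap F M c) ≠ 0 := by simpa using hc0
    simp only [Units.val_mul, map_mul, Units.val_inv_eq_inv_val, map_inv₀]
    exact (inv_mul_eq_one₀ hc0').mpr hc.symm

theorem ramIndex_eq_card (B : ValuationSubring M) :
    ramIndex F B = Nat.card (Mˣ ⧸ baseValueSubgroup F B) := by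
  rw [← Subgroup.index_eq_card]
  unfold baseValueSubgroup ramIndex
  rw [Subgroup.index_comap_of_surjective _ (QuotientGroup.mk'_surjective _)]

theorem mk_eq_mk_iff {B : ValuationSubring M} {x y : Mˣ} :
    (x : Mˣ ⧸ baseValueSubgroup F B) = y ↔
      ∃ c : F, B.valuation (y : M) = B.valuation (c • (x : M)) := by
  rw [QuotientGroup.eq, mem_baseValueSubgroup]
  refine exists_congr fun c ↦ ?_
  have hx : B.valuation (x : M) ≠ 0 := by simp
  rw [Algebra.smul_def, Units.val_mul, Units.val_inv_eq_inv_val, map_mul, map_mul, map_inv₀,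
    inv_mul_eq_iff_eq_mul₀ hx, mul_comm (B.valuation (x : M))]

end Ramification

section Defectless

variable {F M : Type*} [Field F] [Field M] [Algebra F M] {A : ValuationSubring F}
  {B : ValuationSubring M}

theorem exists_valuation_sum_eq {ι : Type*} [Fintype ι] [Nonempty ι]
    (hAB : B.comap (algebraMap F M) = A) (Y : ι → B)
    (hind : ∀ a : ι → A, B.valuation (∑ j, algebraMap F M (a j) * (Y j : M)) < 1 →
      ∀ j, A.valuation (a j : F) < 1) (a : ι → F) :
    ∃ j₀, B.valuation (∑ j, algebraMap F M (a j) * (Y j : M)) = B.valuation (algebraMap F M (a j₀)) ∧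
      ∀ j, B.valuation (algebraMap F M (a j)) ≤ B.valuation (algebraMap F M (a j₀)) := by
  obtain ⟨j₀, hj₀⟩ := Finite.exists_max fun j ↦ B.valuation (algebraMap F M (a j))
  refine ⟨j₀, ?_, hj₀⟩
  by_cases h0 : a j₀ = 0
  · have hz : ∀ j, a j = 0 := fun j ↦ by
      have := hj₀ j
      rw [h0, map_zero, map_zero, le_zero_iff, Valuation.zero_iff] at this
      simpa using this
    simp [hz]
  · have hpos : 0 < B.valuation (algebraMap F M (a j₀)) := by simpa [zero_lt_iff] using h0
    have hA : ∀ j, a j / a j₀ ∈ A := fun j ↦ by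
      rw [← valuation_algebraMap_le_one_iff hAB, map_div₀, map_div₀]
      exact div_le_one_of_le₀ (hj₀ j) zero_le
    have hsum : ∑ j, algebraMap F M (a j) * (Y j : M) =
        algebraMap F M (a j₀) * ∑ j, algebraMap F M (a j / a j₀) * (Y j : M) := by
      rw [Finset.mul_sum]
      refine Finset.sum_congr rfl fun j _ ↦ ?_
      rw [← mul_assoc, ← map_mul, mul_div_cancel₀ _ h0]
    have hle : B.valuation (∑ j, algebraMap F M (a j / a j₀) * (Y j : M)) ≤ 1 := by
      refine Valuation.map_sum_le _ fun j _ ↦ ?_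
      rw [map_mul]
      exact mul_le_one' ((valuation_algebraMap_le_one_iff hAB _).mpr (hA j)) (B.valuation_le_one _)
    have hge : ¬ B.valuation (∑ j, algebraMap F M (a j / a j₀) * (Y j : M)) < 1 := by
      intro hlt
      have := hind (fun j ↦ ⟨a j / a j₀, hA j⟩) hlt j₀
      simp [div_self h0] at this
    rw [hsum, map_mul, le_antisymm hle (not_lt.mp hge), mul_one]

theorem exists_valIndep_of_isDefectless [FiniteDimensional F M]
    (hAB : B.comap (algebraMap F M) = A) (h : IsDefectless A B) :
    ∃ b : Fin (Module.finrank F M) → M, ValIndep F B.valuation b := by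
  have hn : 0 < Module.finrank F M := Module.finrank_pos
  have hef : Module.finrank F M = ramIndex F B * residueDegree A B := h
  have he : ramIndex F B ≠ 0 := fun h0 ↦ by simp [hef, h0] at hn
  have hf : residueDegree A B ≠ 0 := fun h0 ↦ by simp [hef, h0] at hn
  have hcard := ramIndex_eq_card (F := F) B
  have : Finite (Mˣ ⧸ baseValueSubgroup F B) := Nat.finite_of_card_ne_zero (hcard ▸ he)
  let _ := Fintype.ofFinite (Mˣ ⧸ baseValueSubgroup F B)
  have : Nonempty (Fin (residueDegree A B)) := ⟨⟨0, Nat.pos_of_ne_zero hf⟩⟩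
  obtain ⟨Y, hY⟩ := exists_residue_family hAB hf
  let x : (Mˣ ⧸ baseValueSubgroup F B) → Mˣ := Quotient.out
  have hx : ∀ q, (x q : Mˣ ⧸ baseValueSubgroup F B) = q := fun q ↦ Quotient.out_eq q
  let b : (Mˣ ⧸ baseValueSubgroup F B) × Fin (residueDegree A B) → M :=
    fun r ↦ (x r.1 : M) * (Y r.2 : M)
  suffices hb : ValIndep F B.valuation b by
    have e : Fin (Module.finrank F M) ≃
        (Mˣ ⧸ baseValueSubgroup F B) × Fin (residueDegree A B) :=
      Fintype.equivOfCardEq (by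
        rw [Fintype.card_prod, Fintype.card_fin, Fintype.card_fin, hef, hcard,
          Nat.card_eq_fintype_card])
    exact ⟨_, hb.reindex e⟩
  refine ⟨fun r hr ↦ ?_, fun c r ↦ ?_⟩
  · have hYr : (Y r.2 : M) = 0 := (mul_eq_zero.mp hr).resolve_left (x r.1).ne_zero
    have := hY (Pi.single r.2 1) (by
      rw [Finset.sum_eq_single r.2 (fun j _ hj ↦ by simp [hj]) (by simp), hYr]
      simp) r.2
    simp at this
  · choose j₀ hj₀ hmax using fun q ↦ exists_valuation_sum_eq hAB Y hY fun j ↦ c (q, j)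
    let t : (Mˣ ⧸ baseValueSubgroup F B) → M :=
      fun q ↦ (x q : M) * ∑ j, algebraMap F M (c (q, j)) * (Y j : M)
    have ht : ∀ q, B.valuation (t q) = B.valuation (c (q, j₀ q) • (x q : M)) := fun q ↦ by
      rw [map_mul, hj₀, Algebra.smul_def, map_mul, mul_comm]
    have hsum : ∑ s, c s • b s = ∑ q, t q := by
      rw [Fintype.sum_prod_type]
      refine Finset.sum_congr rfl fun q _ ↦ ?_
      simp only [t, b, Finset.mul_sum]
      refine Finset.sum_congr rfl fun j _ ↦ ?_
      rw [Algebra.smul_def]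
      ring
    have hterm : B.valuation (c r • b r) ≤ B.valuation (t r.1) := by
      rw [ht, Algebra.smul_def, Algebra.smul_def, map_mul, map_mul, map_mul]
      refine mul_le_mul' (hmax r.1 r.2) ?_
      exact mul_le_of_le_one_right' (B.valuation_le_one _)
    have : Nonempty (Mˣ ⧸ baseValueSubgroup F B) := ⟨r.1⟩
    obtain ⟨q₀, hq₀⟩ := Finite.exists_max fun q ↦ B.valuation (t q)
    refine hterm.trans ((hq₀ _).trans ?_)
    by_cases h0 : B.valuation (t q₀) = 0
    · rw [h0]
      exact zero_le
    rw [hsum, Valuation.map_sum_eq_of_lt _ (Finset.mem_univ q₀)]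
    intro q hq
    refine lt_of_le_of_ne (hq₀ q) fun heq ↦ ?_
    have hne : q ≠ q₀ := by simpa using hq
    apply hne
    rw [← hx q, ← hx q₀, mk_eq_mk_iff]
    have hc0 : c (q₀, j₀ q₀) ≠ 0 := by
      intro hc
      rw [ht, hc] at h0
      simp at h0
    refine ⟨c (q, j₀ q) / c (q₀, j₀ q₀), ?_⟩
    have hc0' : B.valuation (algebraMap F M (c (q₀, j₀ q₀))) ≠ 0 := by simpa using hc0
    rw [ht, ht] at heq
    simp only [Algebra.smul_def, map_mul, map_div₀] at heq ⊢
    rw [div_mul_eq_mul_div, heq, mul_div_cancel_left₀ _ hc0']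

theorem ValIndep.exists_valuation_eq {ι : Type*} [Fintype ι] {b : ι → M} (c : ι → F)
    (hb : ValIndep F B.valuation b) (h0 : ∑ j, c j • b j ≠ 0) :
    ∃ i, B.valuation (∑ j, c j • b j) = B.valuation (c i • b i) := by
  have : Nonempty ι := by
    by_contra hempty
    rw [not_nonempty_iff] at hempty
    simp at h0
  obtain ⟨i, hi⟩ := Finite.exists_max fun j ↦ B.valuation (c j • b j)
  exact ⟨i, le_antisymm (Valuation.map_sum_le _ fun j _ ↦ hi j) (hb.2 c i)⟩

theorem isDefectless_of_valIndep [FiniteDimensional F M] {ι : Type*} [Fintype ι]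
    (hAB : B.comap (algebraMap F M) = A) {b : ι → M} (hb : ValIndep F B.valuation b)
    (hcard : Fintype.card ι = Module.finrank F M) : IsDefectless A B := by
  have hspan : ∀ x : M, ∃ c : ι → F, ∑ j, c j • b j = x := fun x ↦ by
    rw [← Submodule.mem_span_range_iff_exists_fun,
      hb.linearIndependent.span_eq_top_of_card_eq_finrank' hcard]
    trivial
  let κ : ι → Mˣ ⧸ baseValueSubgroup F B := fun i ↦ (Units.mk0 (b i) (hb.1 i) : Mˣ)
  have hκ : ∀ (i : ι) (x : Mˣ), κ i = (x : Mˣ ⧸ baseValueSubgroup F B) ↔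
      ∃ d : F, B.valuation (x : M) = B.valuation (d • b i) := fun i x ↦ mk_eq_mk_iff
  have hsurj : Function.Surjective κ := by
    intro q
    obtain ⟨x, rfl⟩ := QuotientGroup.mk_surjective q
    obtain ⟨c, hc⟩ := hspan x
    obtain ⟨i, hi⟩ := hb.exists_valuation_eq c (by rw [hc]; exact x.ne_zero)
    exact ⟨i, (hκ i x).mpr ⟨c i, by rw [← hi, hc]⟩⟩
  have : Finite (Mˣ ⧸ baseValueSubgroup F B) := Finite.of_surjective κ hsurj
  let _ := Fintype.ofFinite (Mˣ ⧸ baseValueSubgroup F B)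
  have hfib : ∀ q, Fintype.card {i // κ i = q} = residueDegree A B := by
    intro q
    obtain ⟨i₀, rfl⟩ := hsurj q
    have hd : ∀ i : {i // κ i = κ i₀}, ∃ d : F, B.valuation (b i₀) = B.valuation (d • b i) :=
      fun i ↦ (hκ i (Units.mk0 (b i₀) (hb.1 i₀))).mp i.2
    choose d hd using hd
    have hb₀ : B.valuation (b i₀) ≠ 0 := by simpa using hb.1 i₀
    have hYB : ∀ i, d i • b i / b i₀ ∈ B := fun i ↦ by
      rw [← ValuationSubring.valuation_le_one_iff, map_div₀, ← hd, div_self hb₀]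
    have hdiv : ∀ a : {i // κ i = κ i₀} → F,
        ∑ j, algebraMap F M (a j) * (d j • b j / b i₀) = (∑ j, (a j * d j) • b j) / b i₀ := by
      intro a
      rw [Finset.sum_div]
      refine Finset.sum_congr rfl fun j _ ↦ ?_
      simp only [Algebra.smul_def, map_mul]
      ring
    refine (residueDegree_eq_card hAB (fun i ↦ ⟨d i • b i / b i₀, hYB i⟩) ?_ ?_).symm
    · intro a ha j
      simp only [hdiv fun j ↦ (a j : F)] at ha
      rw [map_div₀, div_lt_one₀ (zero_lt_iff.mpr hb₀)] at ha
      let c : ι → F := fun i ↦ if h : κ i = κ i₀ then a ⟨i, h⟩ * d ⟨i, h⟩ else 0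
      have hc : ∑ j, c j • b j = ∑ j : {i // κ i = κ i₀}, ((a j : F) * d j) • b j := by
        rw [← Fintype.sum_subtype_add_sum_subtype (fun i ↦ κ i = κ i₀)]
        rw [Finset.sum_eq_zero (s := (Finset.univ : Finset {i // ¬ κ i = κ i₀}))
          (fun i _ ↦ by simp [c, i.2]), add_zero]
        exact Finset.sum_congr rfl fun i _ ↦ by simp [c, i.2]
      have hlt := (hb.2 c j).trans_lt (hc ▸ ha)
      simp only [c, j.2, dif_pos] at hlt
      rw [mul_smul, Algebra.smul_def, map_mul, ← hd j] at hlt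
      rw [← valuation_algebraMap_lt_one_iff hAB]
      exact (mul_lt_iff_lt_one_left (zero_lt_iff.mpr hb₀)).mp hlt
    · intro y
      obtain ⟨c, hc⟩ := hspan ((y : M) * b i₀)
      have hle : ∀ j, B.valuation (c j • b j) ≤ B.valuation (b i₀) := fun j ↦ by
        refine (hb.2 c j).trans ?_
        rw [hc, map_mul]
        exact mul_le_of_le_one_left' (B.valuation_le_one y)
      have hd0 : ∀ j, d j ≠ 0 := fun j h0 ↦ by
        have := hd j
        rw [h0, zero_smul, map_zero] at this
        exact hb₀ this
      have haA : ∀ j : {i // κ i = κ i₀}, c j / d j ∈ A := fun j ↦ by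
        rw [← valuation_algebraMap_le_one_iff hAB]
        have h1 : c j • b j = algebraMap F M (c j / d j) * (d j • b j) := by
          rw [← Algebra.smul_def, ← mul_smul, div_mul_cancel₀ _ (hd0 j)]
        have h2 := hle j
        rw [h1, map_mul, ← hd j] at h2
        exact (mul_le_iff_le_one_left (zero_lt_iff.mpr hb₀)).mp h2
      refine ⟨fun j ↦ ⟨c j / d j, haA j⟩, ?_⟩
      simp only [hdiv fun j : {i // κ i = κ i₀} ↦ c j / d j]
      have hrest : (y : M) - (∑ j : {i // κ i = κ i₀}, (c j / d j * d j) • b j) / b i₀ =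
          (∑ j : {i // ¬ κ i = κ i₀}, c j • b j) / b i₀ := by
        rw [sub_eq_iff_eq_add, ← add_div, eq_div_iff (hb.1 i₀), ← hc,
          ← Fintype.sum_subtype_add_sum_subtype (fun i ↦ κ i = κ i₀), add_comm]
        congr 1
        exact Finset.sum_congr rfl fun j _ ↦ by rw [div_mul_cancel₀ _ (hd0 j)]
      rw [hrest, map_div₀, div_lt_one₀ (zero_lt_iff.mpr hb₀)]
      refine Valuation.map_sum_lt _ hb₀ fun j _ ↦ lt_of_le_of_ne (hle j) fun heq ↦ j.2 ?_
      exact (hκ j (Units.mk0 (b i₀) (hb.1 i₀))).mpr ⟨c j, heq.symm⟩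
  unfold IsDefectless
  rw [ramIndex_eq_card, Nat.card_eq_fintype_card, ← hcard,
    ← Fintype.card_congr (Equiv.sigmaFiberEquiv κ), Fintype.card_sigma,
    Finset.sum_congr rfl fun q _ ↦ hfib q, Finset.sum_const, Finset.card_univ, smul_eq_mul]

end Defectless

section Cofinal

variable {F Ω Γ : Type*} [Field F] [Field Ω] [Algebra F Ω] [LinearOrderedCommGroupWithZero Γ]

/-- The values of the base field are coinitial in those of an algebraic extension. -/
theorem exists_valuation_algebraMap_le [Algebra.IsAlgebraic F Ω] (w : Valuation Ω Γ) {y : Ω}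
    (hy : y ≠ 0) : ∃ c : F, c ≠ 0 ∧ w (algebraMap F Ω c) ≤ w y := by
  by_cases h1 : 1 ≤ w y
  · exact ⟨1, one_ne_zero, by simpa using h1⟩
  have hint : IsIntegral F y := Algebra.IsIntegral.isIntegral y
  set p := minpoly F y
  have hp0 : p.coeff 0 ≠ 0 := minpoly.coeff_zero_ne_zero hint hy
  have hp0' : w (algebraMap F Ω (p.coeff 0)) ≠ 0 := by simpa using hp0
  by_contra! hcon
  have hlt : ∀ i, w (algebraMap F Ω (p.coeff i)) * w y < w (algebraMap F Ω (p.coeff 0)) := by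
    intro i
    by_cases hi : p.coeff i = 0
    · simpa [hi, zero_lt_iff] using hp0
    · have := hcon (p.coeff 0 / p.coeff i) (div_ne_zero hp0 hi)
      have hi' : 0 < w (algebraMap F Ω (p.coeff i)) := by simpa [zero_lt_iff] using hi
      rwa [map_div₀, map_div₀, lt_div_iff₀ hi', mul_comm] at this
  have hsum := minpoly.aeval F y
  rw [Polynomial.aeval_eq_sum_range, Finset.sum_range_succ'] at hsum
  have := w.map_add_eq_of_lt_right (x := ∑ k ∈ Finset.range p.natDegree, p.coeff (k + 1) • y ^ (k + 1))
    (y := p.coeff 0 • y ^ 0) ?_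
  · rw [hsum, map_zero, pow_zero, Algebra.smul_def, mul_one] at this
    exact hp0' this.symm
  · rw [pow_zero, Algebra.smul_def, mul_one]
    refine w.map_sum_lt hp0' fun k _ ↦ lt_of_le_of_lt ?_ (hlt (k + 1))
    rw [Algebra.smul_def, map_mul, map_pow, pow_succ, ← mul_assoc]
    gcongr
    exact mul_le_of_le_one_right' (pow_le_one' (not_le.mp h1).le k)

/-- A valuation on an algebraic extension that is trivial on the base field is trivial. -/
theorem valuation_eq_one_of_isAlgebraic [Algebra.IsAlgebraic F Ω] (w : Valuation Ω Γ)
    (hw : ∀ c : F, c ≠ 0 → w (algebraMap F Ω c) = 1) {y : Ω} (hy : y ≠ 0) : w y = 1 := by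
  have hge : ∀ {y : Ω}, y ≠ 0 → 1 ≤ w y := fun hy ↦ by
    obtain ⟨c, hc, hle⟩ := exists_valuation_algebraMap_le (F := F) w hy
    rwa [hw c hc] at hle
  refine le_antisymm ?_ (hge hy)
  have := hge (inv_ne_zero hy)
  rwa [map_inv₀, one_le_inv₀ (by simpa [zero_lt_iff] using hy)] at this

theorem ValIndep.of_trivial {ι : Type*} [Fintype ι] (w : Valuation Ω Γ)
    (hw : ∀ y : Ω, y ≠ 0 → w y = 1) {b : ι → Ω} (hb : LinearIndependent F b) :
    ValIndep F w b := by
  refine ⟨hb.ne_zero, fun c i ↦ ?_⟩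
  by_cases hs : ∑ j, c j • b j = 0
  · simp [Fintype.linearIndependent_iff.mp hb c hs i]
  · rw [hw _ hs]
    by_cases hi : c i • b i = 0
    · simp [hi]
    · exact (hw _ hi).le

end Cofinal

section Complete

variable {F Γ : Type*} [Field F] [LinearOrderedCommGroupWithZero Γ] [hF : Valued F Γ]

theorem mem_nhds_iff_exists_lt {s : Set F} {x : F} :
    s ∈ nhds x ↔ ∃ d : F, d ≠ 0 ∧ {y | Valued.v (y - x) < Valued.v d} ⊆ s := by
  rw [Valued.mem_nhds]
  constructor
  · rintro ⟨γ, hγ⟩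
    obtain ⟨d, hd⟩ := MonoidWithZeroHom.ValueGroup₀.restrict₀_surjective (.ofClass hF.v) γ
    refine ⟨d, fun h ↦ γ.ne_zero ?_, fun y hy ↦ hγ ?_⟩
    · rw [← hd, h, map_zero]
    · rw [Set.mem_ofPred_eq, ← hd]
      exact (Valuation.restrict_lt_iff _).mpr hy
  · rintro ⟨d, hd, h⟩
    refine ⟨Units.mk0 (Valued.v.restrict d) (by simpa using hd), fun y hy ↦ h ?_⟩
    exact (Valuation.restrict_lt_iff _).mp hy

theorem exists_limit [CompleteSpace F] {ι : Type*} {G : Filter ι} [G.NeBot] (f : ι → F)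
    (hf : ∀ d : F, d ≠ 0 → ∃ M ∈ G, ∀ a ∈ M, ∀ b ∈ M, Valued.v (f a - f b) < Valued.v d) :
    ∃ l, ∀ d : F, d ≠ 0 → ∀ᶠ a in G, Valued.v (f a - l) < Valued.v d := by
  have hc : Cauchy (G.map f) := by
    rw [Valued.cauchy_iff]
    refine ⟨inferInstance, fun γ ↦ ?_⟩
    obtain ⟨d, hd⟩ := MonoidWithZeroHom.ValueGroup₀.restrict₀_surjective (.ofClass hF.v) γ
    obtain ⟨M, hM, h⟩ := hf d fun h ↦ γ.ne_zero (by rw [← hd, h, map_zero])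
    refine ⟨f '' M, Filter.image_mem_map hM, ?_⟩
    rintro _ ⟨a, ha, rfl⟩ _ ⟨b, hb, rfl⟩
    rw [← hd]
    exact (Valuation.restrict_lt_iff _).mpr (h b hb a ha)
  obtain ⟨l, hl⟩ := CompleteSpace.complete hc
  refine ⟨l, fun d hd ↦ ?_⟩
  have : {y | Valued.v (y - l) < (Valued.v d : Γ)} ∈ nhds l :=
    mem_nhds_iff_exists_lt.mpr ⟨d, hd, subset_rfl⟩
  exact Filter.mem_map.mp (hl this)

section NormEquivalence

variable {Ω Γ' : Type*} [Field Ω] [Algebra F Ω] [Algebra.IsAlgebraic F Ω]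
  [LinearOrderedCommGroupWithZero Γ'] {w : Valuation Ω Γ'}

theorem mem_span_of_forall_exists_lt [CompleteSpace F]
    (hw : (w.comap (algebraMap F Ω)).IsEquiv (Valued.v : Valuation F Γ)) {n : ℕ} {e : Fin n → Ω}
    {z : Ω} (hz : z ≠ 0)
    (he : ∀ (c : Fin n → F) i, w (algebraMap F Ω (c i)) * w z ≤ w (∑ j, c j • e j)) {x : Ω}
    (hx : ∀ y : Ω, y ≠ 0 → ∃ c : Fin n → F, w (x - ∑ j, c j • e j) < w y) :
    ∃ c : Fin n → F, x = ∑ j, c j • e j := by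
  let S : {y : Ω // y ≠ 0} → Set (Fin n → F) := fun y ↦ {c | w (x - ∑ j, c j • e j) < w y}
  let G : Filter (Fin n → F) := ⨅ y, Filter.principal (S y)
  have hS : ∀ y, S y ∈ G := fun y ↦ Filter.mem_iInf_of_mem y (Filter.mem_principal_self _)
  have : Nonempty {y : Ω // y ≠ 0} := ⟨⟨1, one_ne_zero⟩⟩
  have : G.NeBot := by
    refine Filter.iInf_neBot_of_directed ?_ fun y ↦ Filter.principal_neBot_iff.mpr (hx y y.2)
    intro y₁ y₂
    rcases le_total (w y₁.1) (w y₂.1) with h | h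
    · exact ⟨y₁, le_rfl, Filter.principal_mono.mpr fun c hc ↦ lt_of_lt_of_le hc h⟩
    · exact ⟨y₂, Filter.principal_mono.mpr fun c hc ↦ lt_of_lt_of_le hc h, le_rfl⟩
  have hlt : ∀ a b : F, w (algebraMap F Ω a) < w (algebraMap F Ω b) ↔
      (Valued.v a : Γ) < Valued.v b := fun a b ↦
    (Valuation.isEquiv_iff_val_lt_val.mp hw (x := a) (y := b))
  have hlim : ∀ i, ∃ l, ∀ d : F, d ≠ 0 →
      ∀ᶠ c : Fin n → F in G, Valued.v (c i - l) < (Valued.v d : Γ) := by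
    intro i
    refine exists_limit (fun c : Fin n → F ↦ c i) fun d hd ↦ ?_
    refine ⟨_, hS ⟨algebraMap F Ω d * z, mul_ne_zero (by simpa using hd) hz⟩, ?_⟩
    intro a ha b hb
    have h1 : w (∑ j, (a - b) j • e j) < w (algebraMap F Ω d * z) := by
      have : ∑ j, (a - b) j • e j = (x - ∑ j, b j • e j) - (x - ∑ j, a j • e j) := by
        simp [sub_smul, Finset.sum_sub_distrib]
      rw [this]
      exact w.map_sub_lt hb ha
    have h2 := lt_of_le_of_lt (he (a - b) i) h1
    rw [map_mul] at h2
    exact (hlt _ _).mp (lt_of_mul_lt_mul_right' h2)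
  choose l hl using hlim
  refine ⟨l, ?_⟩
  by_contra hne
  set y := x - ∑ j, l j • e j with hy
  have hy0 : y ≠ 0 := sub_ne_zero.mpr hne
  have hev : ∀ i, ∀ᶠ c : Fin n → F in G, w ((c i - l i) • e i) < w y := by
    intro i
    by_cases hei : e i = 0
    · simp [hei, zero_lt_iff, hy0]
    obtain ⟨d, hd, hdle⟩ := exists_valuation_algebraMap_le (F := F) w (div_ne_zero hy0 hei)
    filter_upwards [hl i d hd] with c hc
    rw [← hlt] at hc
    have h3 := lt_of_lt_of_le hc hdle
    have hei' : 0 < w (e i) := by simpa [zero_lt_iff] using hei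
    rw [map_div₀, lt_div_iff₀ hei'] at h3
    rwa [Algebra.smul_def, map_mul]
  obtain ⟨c, hc1, hc2⟩ := ((Filter.eventually_all.mpr hev).and (hS ⟨y, hy0⟩)).exists
  have hyc : y = (x - ∑ j, c j • e j) + ∑ j, (c j - l j) • e j := by
    simp [hy, sub_smul, Finset.sum_sub_distrib]
  have h4 : w (∑ j, (c j - l j) • e j) < w y :=
    w.map_sum_lt (by simpa using hy0) fun j _ ↦ hc1 j
  have h5 := w.map_add_lt hc2 h4
  rw [← hyc] at h5
  exact lt_irrefl _ h5

/-- Over a complete field, coordinates with respect to a finite linearly independent family are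
bounded. -/
theorem exists_forall_mul_le_valuation_sum [CompleteSpace F]
    (hw : (w.comap (algebraMap F Ω)).IsEquiv (Valued.v : Valuation F Γ)) {n : ℕ} {e : Fin n → Ω}
    (he : LinearIndependent F e) :
    ∃ z : Ω, z ≠ 0 ∧
      ∀ (c : Fin n → F) i, w (algebraMap F Ω (c i)) * w z ≤ w (∑ j, c j • e j) := by
  induction n with
  | zero => exact ⟨1, one_ne_zero, fun c i ↦ i.elim0⟩
  | succ n ih =>
    obtain ⟨htail, hnot⟩ := linearIndependent_finSucc.mp he
    obtain ⟨z', hz', hbound⟩ := ih htail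
    have hnotlim : ¬ ∀ y : Ω, y ≠ 0 →
        ∃ c : Fin n → F, w (e 0 - ∑ j, c j • Fin.tail e j) < w y := by
      intro h
      obtain ⟨c, hc⟩ := mem_span_of_forall_exists_lt hw hz' hbound h
      exact hnot (Submodule.mem_span_range_iff_exists_fun F |>.mpr ⟨c, hc.symm⟩)
    push Not at hnotlim
    obtain ⟨y, hy, hyle⟩ := hnotlim
    have he0 : e 0 ≠ 0 := he.ne_zero 0
    have he0' : w (e 0) ≠ 0 := by simpa using he0
    obtain ⟨z, hz, hz1, hz2, hz3⟩ : ∃ z : Ω, z ≠ 0 ∧ w z ≤ w y ∧ w z ≤ w z' ∧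
        w z ≤ w (z' * y / e 0) := by
      have hthree : ∀ a b : Ω, a ≠ 0 → b ≠ 0 → ∃ c, c ≠ 0 ∧ w c ≤ w a ∧ w c ≤ w b := by
        intro a b ha hb
        rcases le_total (w a) (w b) with h | h
        · exact ⟨a, ha, le_rfl, h⟩
        · exact ⟨b, hb, h, le_rfl⟩
      obtain ⟨a, ha, ha1, ha2⟩ := hthree y z' hy hz'
      obtain ⟨b, hb, hb1, hb2⟩ := hthree a _ ha (div_ne_zero (mul_ne_zero hz' hy) he0)
      exact ⟨b, hb, hb1.trans ha1, hb1.trans ha2, hb2⟩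
    refine ⟨z, hz, fun c ↦ ?_⟩
    have hhead : w (algebraMap F Ω (c 0)) * w y ≤ w (∑ j, c j • e j) := by
      by_cases hc0 : c 0 = 0
      · simp [hc0]
      · have h1 := hyle (fun j ↦ - (c 0)⁻¹ * c j.succ)
        have h2 : ∑ j, c j • e j = algebraMap F Ω (c 0) *
            (e 0 - ∑ j : Fin n, (- (c 0)⁻¹ * c j.succ) • Fin.tail e j) := by
          rw [Fin.sum_univ_succ, mul_sub, Finset.mul_sum, sub_eq_add_neg,
            ← Finset.sum_neg_distrib, Algebra.smul_def]
          congr 1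
          refine Finset.sum_congr rfl fun j _ ↦ ?_
          rw [← Algebra.smul_def, smul_smul, ← neg_smul, Fin.tail]
          congr 1
          field_simp
        rw [h2, map_mul]
        gcongr
    have htailsum : w (∑ j : Fin n, c j.succ • e j.succ) * (w z) ≤ w (∑ j, c j • e j) * w z' := by
      have h3 : ∑ j : Fin n, c j.succ • e j.succ = ∑ j, c j • e j - c 0 • e 0 := by
        rw [Fin.sum_univ_succ, add_sub_cancel_left]
      rw [h3, ← map_mul, sub_mul]
      refine (w.map_sub _ _).trans (max_le ?_ ?_)
      · rw [map_mul]
        gcongr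
      · rw [Algebra.smul_def, map_mul, map_mul]
        calc w (algebraMap F Ω (c 0)) * w (e 0) * w z
            ≤ w (algebraMap F Ω (c 0)) * w (e 0) * w (z' * y / e 0) := by gcongr
          _ = (w (algebraMap F Ω (c 0)) * w y) * w z' := by
            rw [map_div₀, map_mul]
            field_simp
          _ ≤ _ := by gcongr
    intro i
    refine Fin.cases ?_ (fun i ↦ ?_) i
    · refine le_trans ?_ hhead
      gcongr
    · have h4 := hbound (fun j ↦ c j.succ) i
      have hz0 : 0 < w z' := by simpa [zero_lt_iff] using hz'
      refine le_of_mul_le_mul_right ?_ hz0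
      calc _ = w (algebraMap F Ω (c i.succ)) * w z' * w z := mul_right_comm _ _ _
        _ ≤ w (∑ j : Fin n, c j.succ • e j.succ) * w z := by
          gcongr
          exact h4
        _ ≤ _ := htailsum

end NormEquivalence

end Complete

section Approximation

theorem exists_comap_eq {E Ω : Type*} [Field E] [Field Ω] [Algebra E Ω] (B : ValuationSubring E) :
    ∃ C : ValuationSubring Ω, C.comap (algebraMap E Ω) = B := by
  let g : B →+* Ω := (algebraMap E Ω).comp B.subtype
  obtain ⟨C, hC⟩ := (LocalSubring.range g).exists_le_valuationSubring
  obtain ⟨hle, hloc⟩ := hC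
  have hBC : ∀ x ∈ B, algebraMap E Ω x ∈ C := fun x hx ↦ hle ⟨⟨x, hx⟩, rfl⟩
  refine ⟨C, le_antisymm (fun x hx ↦ ?_) fun x hx ↦ hBC x hx⟩
  by_contra hxB
  have hx0 : x ≠ 0 := fun h ↦ hxB (h ▸ B.zero_mem)
  have hy : x⁻¹ ∈ B := (B.mem_or_inv_mem x).resolve_left hxB
  let t : (LocalSubring.range g).toSubring := ⟨algebraMap E Ω x⁻¹, ⟨⟨x⁻¹, hy⟩, rfl⟩⟩
  have hunit : IsUnit (Subring.inclusion hle t) := by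
    refine IsUnit.of_mul_eq_one ⟨algebraMap E Ω x, hx⟩ (Subtype.ext ?_)
    change algebraMap E Ω x⁻¹ * algebraMap E Ω x = 1
    rw [← map_mul, inv_mul_cancel₀ hx0, map_one]
  obtain ⟨⟨_, ⟨s, rfl⟩⟩, hs⟩ := isUnit_iff_exists_inv.mp (hloc.map_nonunit t hunit)
  have hs' : algebraMap E Ω x⁻¹ * algebraMap E Ω s = 1 := congrArg Subtype.val hs
  rw [← map_mul, ← map_one (algebraMap E Ω)] at hs'
  have := (algebraMap E Ω).injective hs'
  rw [inv_mul_eq_one₀ hx0] at this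
  exact hxB (this ▸ s.2)

variable {Ω Γ : Type*} [Field Ω] [LinearOrderedCommGroupWithZero Γ]

theorem exists_forall_valuation_le {κ : Type*} [Finite κ] (w : Valuation Ω Γ) {y : κ → Ω}
    (hy : ∀ k, y k ≠ 0) : ∃ y₀ : Ω, y₀ ≠ 0 ∧ ∀ k, w y₀ ≤ w (y k) := by
  cases isEmpty_or_nonempty κ
  · exact ⟨1, one_ne_zero, fun k ↦ isEmptyElim k⟩
  · obtain ⟨k₀, hk₀⟩ := Finite.exists_min fun k ↦ w (y k)
    exact ⟨y k₀, hy k₀, hk₀⟩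

theorem exists_forall_lt_of_continuous [Valued Ω Γ] {ι : Type*} [Finite ι] {f : (ι → Ω) → Ω}
    (hf : Continuous f) (x : ι → Ω) {z : Ω} (hz : z ≠ 0) :
    ∃ y : Ω, y ≠ 0 ∧ ∀ x' : ι → Ω, (∀ i, Valued.v (x' i - x i) < (Valued.v y : Γ)) →
      Valued.v (f x' - f x) < (Valued.v z : Γ) := by
  have hball : {u | Valued.v (u - f x) < (Valued.v z : Γ)} ∈ nhds (f x) :=
    mem_nhds_iff_exists_lt.mpr ⟨z, hz, subset_rfl⟩
  have hpre := hf.continuousAt.preimage_mem_nhds hball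
  rw [nhds_pi, Filter.mem_pi'] at hpre
  obtain ⟨I, t, ht, hsub⟩ := hpre
  choose y hy hyt using fun i ↦ mem_nhds_iff_exists_lt.mp (ht i)
  obtain ⟨y₀, hy₀, hle⟩ := exists_forall_valuation_le Valued.v hy
  exact ⟨y₀, hy₀, fun x' hx' ↦ hsub fun i _ ↦ hyt i ((hx' i).trans_le (hle i))⟩

/-- Polynomial expressions depend continuously on the coefficients and the argument. -/
theorem exists_forall_sum_sub_lt (w : Valuation Ω Γ) (N : ℕ) (c : Fin N → Ω) (a : Ω) {z : Ω}
    (hz : z ≠ 0) : ∃ y : Ω, y ≠ 0 ∧ ∀ (c' : Fin N → Ω) (a' : Ω), (∀ i, w (c' i - c i) < w y) →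
      w (a' - a) < w y → w (∑ i, c' i * a' ^ (i : ℕ) - ∑ i, c i * a ^ (i : ℕ)) < w z := by
  let _ := Valued.mk' w
  have hf : Continuous fun x : Option (Fin N) → Ω ↦ ∑ i, x (some i) * x none ^ (i : ℕ) := by
    fun_prop
  obtain ⟨y, hy, h⟩ := exists_forall_lt_of_continuous (Γ := Γ) hf (fun o ↦ o.elim a c) hz
  refine ⟨y, hy, fun c' a' hc ha ↦ h (fun o ↦ o.elim a' c') ?_⟩
  rintro (_ | i)
  · exact ha
  · exact hc i

theorem exists_root_sub_lt (w : Valuation Ω Γ) {g : Polynomial Ω} (hg : g.Monic) (hs : g.Splits)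
    {a ε : Ω} (h : w (g.eval a) < w ε ^ g.natDegree) : ∃ r, g.eval r = 0 ∧ w (r - a) < w ε := by
  by_contra! hcon
  have hprod : g.eval a = (g.roots.map fun r ↦ a - r).prod := by
    conv_lhs => rw [hs.eq_prod_roots_of_monic hg]
    rw [Polynomial.eval_multiset_prod, Multiset.map_map]
    simp
  refine not_le.mpr h ?_
  rw [hprod, map_multiset_prod, hs.natDegree_eq_card_roots,
    ← Multiset.card_map (fun r ↦ a - r) g.roots, ← Multiset.card_map w]
  refine Multiset.pow_card_le_prod fun x hx ↦ ?_
  rw [Multiset.map_map, Multiset.mem_map] at hx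
  obtain ⟨r, hr, rfl⟩ := hx
  rw [Function.comp_apply, w.map_sub_swap]
  exact hcon r (Polynomial.isRoot_of_mem_roots hr)

/-- A polynomial with nonzero constant coefficient becomes separable after adding a suitable small
linear term. -/
theorem exists_separable_add_C_mul_X [IsAlgClosed Ω] {L : Type*} [Field L] [Algebra L Ω]
    (w : Valuation Ω Γ) {k : L} (hk0 : k ≠ 0) (hk1 : w (algebraMap L Ω k) < 1)
    (hco : ∀ y : Ω, y ≠ 0 → ∃ c : L, c ≠ 0 ∧ w (algebraMap L Ω c) < w y)
    {f : Polynomial L} (hf : f.coeff 0 ≠ 0) {y : Ω} (hy : y ≠ 0) :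
    ∃ d : L, w (algebraMap L Ω d) < w y ∧ (f + Polynomial.C d * Polynomial.X).Separable := by
  obtain ⟨c, hc, hcy⟩ := hco y hy
  let h : Polynomial Ω := (f - Polynomial.X * Polynomial.derivative f).map (algebraMap L Ω)
  have hh : h ≠ 0 := by
    refine (Polynomial.map_ne_zero_iff (algebraMap L Ω).injective).mpr fun h0 ↦ hf ?_
    have := congrArg (Polynomial.coeff · 0) h0
    simpa [Polynomial.mul_coeff_zero] using this
  have hbad : ((fun x ↦ - Polynomial.aeval x (Polynomial.derivative f)) '' (h.rootSet Ω)).Finite :=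
    (h.rootSet_finite Ω).image _
  have hinj : Function.Injective fun m : ℕ ↦ algebraMap L Ω (c * k ^ m) := by
    intro m m' hmm
    have h1 := mul_left_cancel₀ hc ((algebraMap L Ω).injective hmm)
    have h2 : w (algebraMap L Ω k) ^ m = w (algebraMap L Ω k) ^ m' := by
      rw [← map_pow, ← map_pow, ← map_pow, ← map_pow, h1]
    exact (pow_right_strictAnti₀ (by simpa [zero_lt_iff] using hk0) hk1).injective h2
  obtain ⟨_, ⟨m, rfl⟩, hm⟩ := (Set.infinite_range_of_injective hinj).exists_notMem_finite hbad
  refine ⟨c * k ^ m, lt_of_le_of_lt ?_ hcy, ?_⟩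
  · rw [map_mul, map_mul, map_pow, map_pow]
    exact mul_le_of_le_one_right' (pow_le_one' hk1.le m)
  · rw [Polynomial.Separable, Polynomial.isCoprime_iff_aeval_ne_zero_of_isAlgClosed L Ω]
    intro x
    by_contra! hx
    obtain ⟨h1, h2⟩ := hx
    simp only [map_add, map_mul, Polynomial.aeval_C, Polynomial.aeval_X, Polynomial.derivative_mul,
      Polynomial.derivative_C, Polynomial.derivative_X, zero_mul, mul_zero, zero_add,
      mul_one] at h1 h2
    refine hm ⟨x, ?_, ?_⟩
    · rw [Polynomial.mem_rootSet]
      refine ⟨hh, ?_⟩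
      simp only [h, Polynomial.aeval_map_algebraMap, map_sub, map_mul, Polynomial.aeval_X]
      linear_combination h1 - x * h2
    · simp only [map_mul]
      linear_combination -h2

/-- Every finite subset of `s` can be approximated arbitrarily well by elements of a finite
separable extension of `K` of degree at most `n`. -/
def HasSepApprox (K : Type*) [Field K] [Algebra K Ω] (w : Valuation Ω Γ) (n : ℕ) (s : Set Ω) :
    Prop :=
  ∀ t : Finset Ω, (t : Set Ω) ⊆ s → ∀ z : Ω, z ≠ 0 → ∃ L : IntermediateField K Ω,
    FiniteDimensional K L ∧ Algebra.IsSeparable K L ∧ Module.finrank K L ≤ n ∧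
      ∀ x ∈ t, ∃ l : L, w (x - l) < w z

open Polynomial IntermediateField in
theorem HasSepApprox.adjoin [IsAlgClosed Ω] {K E : Type*} [Field K] [Field E] [Algebra K Ω]
    [Algebra E Ω] {w : Valuation Ω Γ} {k : K} (hk0 : k ≠ 0) (hk1 : w (algebraMap K Ω k) < 1)
    (hco : ∀ y : Ω, y ≠ 0 → ∃ c : K, c ≠ 0 ∧ w (algebraMap K Ω c) < w y) {m : ℕ}
    (h : HasSepApprox K w m (Set.range (algebraMap E Ω))) {a : Ω} (ha : IsIntegral E a)
    (haE : a ∉ (algebraMap E Ω).range) :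
    HasSepApprox K w (m * (minpoly E a).natDegree) (Set.range (aeval (R := E) a)) := by
  intro t ht z hz
  have ha0 : a ≠ 0 := fun h0 ↦ haE (h0 ▸ zero_mem _)
  set f := minpoly E a
  set n := f.natDegree
  have hn : 2 ≤ n := (minpoly.two_le_natDegree_iff ha).mpr haE
  have hf0 : algebraMap E Ω (f.coeff 0) ≠ 0 := by
    simpa using minpoly.coeff_zero_ne_zero ha ha0
  have hex : ∀ x ∈ t, ∃ q : E[X], aeval a q = x := fun x hx ↦ ht hx
  choose! q hq using hex
  let N := t.sup (fun x ↦ (q x).natDegree) + 1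
  have hqx : ∀ x ∈ t, x = ∑ i : Fin N, algebraMap E Ω ((q x).coeff i) * a ^ (i : ℕ) := by
    intro x hx
    conv_lhs => rw [← hq x hx, aeval_eq_sum_range' (n := N)
      (Nat.lt_succ_of_le (Finset.le_sup (f := fun x ↦ (q x).natDegree) hx)), Finset.sum_range]
    simp only [Algebra.smul_def]
  choose ε hε0 hε using fun x : t ↦ exists_forall_sum_sub_lt w N
    (fun i ↦ algebraMap E Ω ((q x).coeff i)) a hz
  obtain ⟨ε, hε0, hεle⟩ := exists_forall_valuation_le w hε0
  have hfa : a ^ n + ∑ i : Fin n, algebraMap E Ω (f.coeff i) * a ^ (i : ℕ) = 0 := by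
    have h1 := minpoly.aeval E a
    rw [(minpoly.monic ha).as_sum] at h1
    simpa [Finset.sum_range] using h1
  obtain ⟨δf, hδf0, hδf⟩ := exists_forall_sum_sub_lt w n
    (fun i ↦ algebraMap E Ω (f.coeff i)) a (pow_ne_zero n hε0)
  obtain ⟨δ, hδ0, hδ⟩ := exists_forall_valuation_le w
    (y := ![ε, δf, algebraMap E Ω (f.coeff 0)]) (by
      intro i
      fin_cases i
      · exact hε0
      · exact hδf0
      · exact hf0)
  have hδ1 : w δ ≤ w ε := hδ 0
  have hδ2 : w δ ≤ w δf := hδ 1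
  have hδ3 : w δ ≤ w (algebraMap E Ω (f.coeff 0)) := hδ 2
  let T : Finset Ω := (Finset.range n).image (fun i ↦ algebraMap E Ω (f.coeff i)) ∪
    (t ×ˢ Finset.range N).image (fun r ↦ algebraMap E Ω ((q r.1).coeff r.2))
  have hTf : ∀ i : Fin n, algebraMap E Ω (f.coeff i) ∈ T := fun i ↦
    Finset.mem_union_left _ (Finset.mem_image.mpr ⟨i, Finset.mem_range.mpr i.2, rfl⟩)
  have hTq : ∀ x ∈ t, ∀ i : Fin N, algebraMap E Ω ((q x).coeff i) ∈ T := fun x hx i ↦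
    Finset.mem_union_right _ (Finset.mem_image.mpr
      ⟨(x, i), Finset.mem_product.mpr ⟨hx, Finset.mem_range.mpr i.2⟩, rfl⟩)
  obtain ⟨L, hLfin, hLsep, hLm, hL⟩ := h T (by
    intro u hu
    rcases Finset.mem_union.mp hu with hu | hu <;>
    · obtain ⟨_, _, rfl⟩ := Finset.mem_image.mp hu
      exact ⟨_, rfl⟩) δ hδ0
  choose! ap hap using hL
  let r : L[X] := ∑ i : Fin n, C (ap (algebraMap E Ω (f.coeff i))) * X ^ (i : ℕ)
  have hr : r.degree < n := degree_sum_fin_lt _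
  have hcoeff : (X ^ n + r).coeff 0 ≠ 0 := by
    have h1 : (X ^ n + r).coeff 0 = ap (algebraMap E Ω (f.coeff 0)) := by
      have : NeZero n := ⟨by lia⟩
      simp only [r, coeff_add, coeff_X_pow, finsetSum_coeff, coeff_C_mul]
      rw [if_neg (by lia), zero_add, Finset.sum_eq_single (0 : Fin n)]
      · simp
      · intro b _ hb
        rw [if_neg (fun h0 ↦ hb (Fin.ext h0.symm)), mul_zero]
      · simp
    rw [h1]
    intro h0
    have h2 := (hap _ (hTf ⟨0, by lia⟩)).trans_le hδ3
    rw [h0] at h2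
    simp at h2
  obtain ⟨d, hd, hsep⟩ := exists_separable_add_C_mul_X (L := L) w (k := algebraMap K L k)
    (by simpa using hk0) (by rwa [← IsScalarTower.algebraMap_apply]) (by
      intro y hy
      obtain ⟨c, hc, hcy⟩ := hco y hy
      exact ⟨algebraMap K L c, by simpa using hc, by rwa [← IsScalarTower.algebraMap_apply]⟩)
    hcoeff (div_ne_zero (pow_ne_zero n hε0) ha0)
  set g : L[X] := X ^ n + r + C d * X with hg
  have hrd : (r + C d * X).degree < (n : WithBot ℕ) := by
    refine (degree_add_le _ _).trans_lt (max_lt hr ?_)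
    refine (degree_C_mul_X_le d).trans_lt ?_
    exact_mod_cast hn
  have hgmonic : g.Monic := by
    rw [hg, add_assoc]
    exact monic_X_pow_add hrd
  have hgdeg : g.natDegree = n := by
    rw [hg, add_assoc]
    refine natDegree_eq_of_degree_eq_some ?_
    rw [degree_add_eq_left_of_degree_lt (by rwa [degree_X_pow]), degree_X_pow]
  have hga : w ((g.map (algebraMap L Ω)).eval a) < w ε ^ (g.map (algebraMap L Ω)).natDegree := by
    rw [natDegree_map, hgdeg, ← map_pow]
    have h1 : (g.map (algebraMap L Ω)).eval a =
        (∑ i : Fin n, (ap (algebraMap E Ω (f.coeff i)) : Ω) * a ^ (i : ℕ) -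
          ∑ i : Fin n, algebraMap E Ω (f.coeff i) * a ^ (i : ℕ)) + algebraMap L Ω d * a := by
      rw [eval_map_algebraMap, hg]
      simp only [r, map_add, map_sum, map_mul, map_pow, aeval_X, aeval_C]
      linear_combination (norm := skip) hfa
      simp only [IntermediateField.algebraMap_apply]
      ring
    rw [h1]
    refine w.map_add_lt (hδf _ _ (fun i ↦ ?_) ?_) ?_
    · rw [w.map_sub_swap]
      exact (hap _ (hTf i)).trans_le hδ2
    · simpa [zero_lt_iff] using hδf0
    · have ha0' : 0 < w a := by simpa [zero_lt_iff] using ha0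
      rwa [map_div₀, lt_div_iff₀ ha0', ← map_mul] at hd
  obtain ⟨b, hb0, hb⟩ := exists_root_sub_lt w (hgmonic.map (algebraMap L Ω))
    (IsAlgClosed.splits _) hga
  rw [eval_map_algebraMap] at hb0
  have hbint : IsIntegral L b := ⟨g, hgmonic, hb0⟩
  have hbsep : IsSeparable L b := hsep.of_dvd (minpoly.dvd L b hb0)
  have hsep' : Algebra.IsSeparable L L⟮b⟯ :=
    (isSeparable_adjoin_simple_iff_isSeparable L Ω).mpr hbsep
  have hfin' : FiniteDimensional L L⟮b⟯ := adjoin.finiteDimensional hbint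
  refine ⟨L⟮b⟯.restrictScalars K, ?_, ?_, ?_, ?_⟩
  · exact FiniteDimensional.trans K L L⟮b⟯
  · exact Algebra.IsSeparable.trans K L L⟮b⟯
  · change Module.finrank K L⟮b⟯ ≤ _
    have : Module.Free K L := Module.Free.of_divisionRing _ _
    have : Module.Free L L⟮b⟯ := Module.Free.of_divisionRing _ _
    rw [← Module.finrank_mul_finrank K L L⟮b⟯, adjoin.finrank hbint]
    refine Nat.mul_le_mul hLm ?_
    rw [← hgdeg]
    exact natDegree_le_of_dvd (minpoly.dvd L b hb0) hgmonic.ne_zero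
  · intro x hx
    refine ⟨⟨∑ i : Fin N, (ap (algebraMap E Ω ((q x).coeff i)) : Ω) * b ^ (i : ℕ), ?_⟩, ?_⟩
    · exact sum_mem fun i _ ↦ mul_mem (L⟮b⟯.algebraMap_mem _)
        (pow_mem (mem_adjoin_simple_self L b) _)
    · rw [w.map_sub_swap]
      refine lt_of_eq_of_lt (congrArg (fun u ↦ w (_ - u)) (hqx x hx))
        (hε ⟨x, hx⟩ _ _ (fun i ↦ ?_) (hb.trans_le (hεle ⟨x, hx⟩)))
      rw [w.map_sub_swap]
      exact (hap _ (hTq x hx i)).trans_le (hδ1.trans (hεle ⟨x, hx⟩))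

end Approximation

section Dense

theorem ValIndep.of_dense {K F M Γ ι : Type*} [Field K] [Field F] [Field M] [Algebra K F]
    [Algebra K M] [Algebra F M] [IsScalarTower K F M] [LinearOrderedCommGroupWithZero Γ]
    [Fintype ι] {w : Valuation M Γ} {b : ι → M} (h : ValIndep K w b)
    (hd : ∀ x : F, x ≠ 0 → ∃ k : K,
      w (algebraMap F M x - algebraMap K M k) < w (algebraMap F M x)) : ValIndep F w b := by
  refine ⟨h.1, fun c i ↦ ?_⟩
  have hex : ∀ x : F, ∃ k : K, w (algebraMap K M k) = w (algebraMap F M x) ∧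
      (x ≠ 0 → w (algebraMap F M x - algebraMap K M k) < w (algebraMap F M x)) := by
    intro x
    by_cases hx : x = 0
    · exact ⟨0, by simp [hx], fun h ↦ absurd hx h⟩
    · obtain ⟨k, hk⟩ := hd x hx
      refine ⟨k, ?_, fun _ ↦ hk⟩
      rw [w.map_sub_swap] at hk
      have := w.map_add_eq_of_lt_right hk
      rwa [sub_add_cancel] at this
  choose a ha ha' using hex
  have hval : ∀ j, w (a (c j) • b j) = w (c j • b j) := fun j ↦ by
    rw [Algebra.smul_def, Algebra.smul_def, map_mul, map_mul, ha]
  by_cases hc : c = 0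
  · simp [hc]
  have hs : w (∑ j, a (c j) • b j) ≠ 0 := by
    intro h0
    refine hc (funext fun j ↦ ?_)
    have h1 := Fintype.linearIndependent_iff.mp h.linearIndependent _ ((Valuation.zero_iff _).mp h0)
      j
    have h2 := ha (c j)
    rw [h1, map_zero, map_zero, eq_comm, Valuation.zero_iff] at h2
    simpa using h2
  have hsum : w (∑ j, c j • b j) = w (∑ j, a (c j) • b j) := by
    have hsplit : ∑ j, c j • b j = ∑ j, (c j • b j - a (c j) • b j) + ∑ j, a (c j) • b j := by
      rw [Finset.sum_sub_distrib, sub_add_cancel]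
    rw [hsplit]
    refine w.map_add_eq_of_lt_right (w.map_sum_lt hs fun j _ ↦ ?_)
    by_cases hj : c j = 0
    · have h2 := ha (c j)
      rw [hj, map_zero, map_zero, Valuation.zero_iff, map_eq_zero] at h2
      simpa [hj, h2, zero_lt_iff] using hs
    · refine lt_of_lt_of_le ?_ (h.2 (fun j ↦ a (c j)) j)
      rw [hval, Algebra.smul_def, Algebra.smul_def, ← sub_mul, map_mul, map_mul]
      exact mul_lt_mul_of_pos_right (ha' _ hj) (by simpa [zero_lt_iff] using h.1 j)
  rw [hsum, ← hval]
  exact h.2 (fun j ↦ a (c j)) i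

open IntermediateField in
theorem hasSepApprox_of_fg {K F Ω Γ : Type*} [Field K] [Field F] [Field Ω] [IsAlgClosed Ω]
    [Algebra K F] [Algebra K Ω] [Algebra F Ω] [IsScalarTower K F Ω] [Algebra.IsAlgebraic F Ω]
    [LinearOrderedCommGroupWithZero Γ] {w : Valuation Ω Γ}
    (hd : ∀ (x : F) (y : Ω), y ≠ 0 → ∃ k : K, w (algebraMap F Ω x - algebraMap K Ω k) < w y)
    {k : K} (hk0 : k ≠ 0) (hk1 : w (algebraMap K Ω k) < 1) (E : IntermediateField F Ω)
    (hE : E.FG) : HasSepApprox K w (Module.finrank F E) (E : Set Ω) := by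
  have hco : ∀ y : Ω, y ≠ 0 → ∃ c : K, c ≠ 0 ∧ w (algebraMap K Ω c) < w y := by
    intro y hy
    obtain ⟨x, hx, hxy⟩ := exists_valuation_algebraMap_le (F := F) w hy
    have hx' : algebraMap F Ω x ≠ 0 := by simpa using hx
    obtain ⟨c, hc⟩ := hd x _ hx'
    rw [w.map_sub_swap] at hc
    have hcx := w.map_add_eq_of_lt_right hc
    rw [sub_add_cancel] at hcx
    have hc0 : c ≠ 0 := by
      rintro rfl
      rw [map_zero, map_zero, eq_comm, Valuation.zero_iff] at hcx
      exact hx' hcx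
    refine ⟨c * k, mul_ne_zero hc0 hk0, lt_of_lt_of_le ?_ hxy⟩
    rw [map_mul, map_mul, hcx]
    exact mul_lt_of_lt_one_right (by simpa [zero_lt_iff] using hx) hk1
  refine induction_on_adjoin_fg
    (fun E : IntermediateField F Ω ↦ HasSepApprox K w (Module.finrank F E) (E : Set Ω)) ?_ ?_ E hE
  · intro t ht z hz
    refine ⟨⊥, inferInstance, inferInstance, ?_, fun x hx ↦ ?_⟩
    · rw [IntermediateField.finrank_bot, IntermediateField.finrank_bot]
    · obtain ⟨y, rfl⟩ := IntermediateField.mem_bot.mp (ht hx)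
      obtain ⟨c, hc⟩ := hd y z hz
      exact ⟨algebraMap K _ c, hc⟩
  · intro E a hEa
    by_cases ha : a ∈ E
    · have h1 : (↥E)⟮a⟯ = ⊥ := adjoin_simple_eq_bot_iff.mpr
        (IntermediateField.mem_bot.mpr ⟨⟨a, ha⟩, rfl⟩)
      rw [h1, restrictScalars_bot_eq_self]
      exact hEa
    · have hint : IsIntegral E a := Algebra.IsIntegral.isIntegral a
      have hrange : Set.range (algebraMap E Ω) = (E : Set Ω) := Subtype.range_coe
      rw [← hrange] at hEa
      have := hEa.adjoin hk0 hk1 hco hint (fun h ↦ ha (by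
        obtain ⟨y, rfl⟩ := h
        exact y.2))
      have hset : Set.range (Polynomial.aeval (R := E) a) =
          ((restrictScalars F (↥E)⟮a⟯ : IntermediateField F Ω) : Set Ω) := by
        ext x
        have h2 : x ∈ (↥E)⟮a⟯ ↔ x ∈ Algebra.adjoin E {a} := by
          rw [← adjoin_simple_toSubalgebra_of_isAlgebraic hint.isAlgebraic]
          rfl
        rw [SetLike.mem_coe, mem_restrictScalars, h2, Algebra.adjoin_singleton_eq_range_aeval]
        rfl
      have hrank : Module.finrank F (restrictScalars F (↥E)⟮a⟯ : IntermediateField F Ω) =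
          Module.finrank F E * (minpoly E a).natDegree := by
        change Module.finrank F (↥E)⟮a⟯ = _
        have : Module.Free F E := Module.Free.of_divisionRing _ _
        have : Module.Free E (↥E)⟮a⟯ := Module.Free.of_divisionRing _ _
        rw [← Module.finrank_mul_finrank F E (↥E)⟮a⟯, adjoin.finrank hint]
      rwa [hrank, ← hset]

end Dense

section SepDefectlessToCompletion

theorem isEquiv_comap_of_comap_eq {F M Γ : Type*} [Field F] [Field M] [Algebra F M]
    [LinearOrderedCommGroupWithZero Γ] {v : Valuation F Γ} {B : ValuationSubring M}
    (hB : B.comap (algebraMap F M) = v.valuationSubring) :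
    (B.valuation.comap (algebraMap F M)).IsEquiv v :=
  (isEquiv_comap_valuation hB).trans v.isEquiv_valuation_valuationSubring.symm

theorem isDefectless_of_isSepDefectlessField {K F E Ω : Type u} {Γ : Type v} [Field K] [Field F]
    [Field E] [Field Ω] [Algebra K F] [Algebra K E] [Algebra F E] [Algebra K Ω] [Algebra F Ω]
    [Algebra E Ω] [IsScalarTower K F E] [IsScalarTower K F Ω] [IsScalarTower F E Ω]
    [IsAlgClosed Ω] [Algebra.IsAlgebraic F Ω] [FiniteDimensional F E]
    [LinearOrderedCommGroupWithZero Γ] [Valued F Γ] [CompleteSpace F]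
    (hd : ∀ x y : F, y ≠ 0 → ∃ k : K, Valued.v (x - algebraMap K F k) < (Valued.v y : Γ))
    {A : ValuationSubring K}
    (hA : (Valued.v : Valuation F Γ).valuationSubring.comap (algebraMap K F) = A)
    (hsep : IsSepDefectlessField A) {B : ValuationSubring E}
    (hB : B.comap (algebraMap F E) = (Valued.v : Valuation F Γ).valuationSubring) :
    IsDefectless (Valued.v : Valuation F Γ).valuationSubring B := by
  have hBv := isEquiv_comap_of_comap_eq hB
  have hBlt : ∀ a b : F, B.valuation (algebraMap F E a) < B.valuation (algebraMap F E b) ↔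
      (Valued.v a : Γ) < Valued.v b := fun a b ↦
    Valuation.isEquiv_iff_val_lt_val.mp hBv (x := a) (y := b)
  have hdB : ∀ x : F, x ≠ 0 → ∃ k : K, B.valuation (algebraMap F E x - algebraMap K E k) <
      B.valuation (algebraMap F E x) := fun x hx ↦ by
    obtain ⟨k, hk⟩ := hd x x hx
    refine ⟨k, ?_⟩
    rwa [IsScalarTower.algebraMap_apply K F E, ← map_sub, hBlt]
  let b := Module.finBasis F E
  by_cases htriv : ∀ k : K, k ≠ 0 → 1 ≤ (Valued.v (algebraMap K F k) : Γ)
  · have hF : ∀ x : F, x ≠ 0 → 1 ≤ (Valued.v x : Γ) := fun x hx ↦ by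
      obtain ⟨k, hk⟩ := hd x x hx
      rw [Valuation.map_sub_swap] at hk
      have hkx := Valuation.map_add_eq_of_lt_right _ hk
      rw [sub_add_cancel] at hkx
      rw [← hkx]
      refine htriv k ?_
      rintro rfl
      rw [map_zero, map_zero, eq_comm, Valuation.zero_iff] at hkx
      exact hx hkx
    have hF1 : ∀ x : F, x ≠ 0 → B.valuation (algebraMap F E x) = 1 := fun x hx ↦ by
      have h1 := hF x hx
      have h2 := hF x⁻¹ (inv_ne_zero hx)
      rw [map_inv₀, one_le_inv₀ (by simpa [zero_lt_iff] using hx)] at h2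
      exact (Valuation.isEquiv_iff_val_eq_one.mp hBv (x := x)).mpr (le_antisymm h2 h1)
    have hE : ∀ y : E, y ≠ 0 → B.valuation y = 1 := fun y hy ↦
      valuation_eq_one_of_isAlgebraic B.valuation hF1 hy
    exact isDefectless_of_valIndep hB (ValIndep.of_trivial B.valuation hE b.linearIndependent)
      (Fintype.card_fin _)
  push Not at htriv
  obtain ⟨k, hk0, hk1⟩ := htriv
  have : IsScalarTower K E Ω := IsScalarTower.of_algebraMap_eq fun x ↦ by
    rw [IsScalarTower.algebraMap_apply K F Ω, IsScalarTower.algebraMap_apply F E Ω,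
      IsScalarTower.algebraMap_apply K F E]
  obtain ⟨C, hC⟩ := exists_comap_eq (Ω := Ω) B
  have hCF : C.comap (algebraMap F Ω) = (Valued.v : Valuation F Γ).valuationSubring := by
    rw [← hB, ← hC, ValuationSubring.comap_comap, ← IsScalarTower.algebraMap_eq]
  have hw := isEquiv_comap_of_comap_eq hCF
  set w := C.valuation
  have hwlt : ∀ a b : F, w (algebraMap F Ω a) < w (algebraMap F Ω b) ↔
      (Valued.v a : Γ) < Valued.v b := fun a b ↦
    Valuation.isEquiv_iff_val_lt_val.mp hw (x := a) (y := b)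
  have hdw : ∀ (x : F) (y : Ω), y ≠ 0 →
      ∃ k : K, w (algebraMap F Ω x - algebraMap K Ω k) < w y := by
    intro x y hy
    obtain ⟨y', hy', hle⟩ := exists_valuation_algebraMap_le (F := F) w hy
    obtain ⟨k, hk⟩ := hd x y' hy'
    refine ⟨k, lt_of_lt_of_le ?_ hle⟩
    rwa [IsScalarTower.algebraMap_apply K F Ω, ← map_sub, hwlt]
  let e : Fin (Module.finrank F E) → Ω := fun i ↦ algebraMap E Ω (b i)
  have he : LinearIndependent F e := b.linearIndependent.map'
    (IsScalarTower.toAlgHom F E Ω).toLinearMap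
    (LinearMap.ker_eq_bot.mpr (algebraMap E Ω).injective)
  obtain ⟨z, hz, hzle⟩ := exists_forall_mul_le_valuation_sum hw he
  let E' : IntermediateField F Ω := (IsScalarTower.toAlgHom F E Ω).fieldRange
  let eq : E ≃ₐ[F] E' := AlgEquiv.ofInjectiveField (IsScalarTower.toAlgHom F E Ω)
  have : FiniteDimensional F E' := eq.toLinearEquiv.finiteDimensional
  have hk1' : w (algebraMap K Ω k) < 1 := by
    rw [IsScalarTower.algebraMap_apply K F Ω]
    exact (Valuation.isEquiv_iff_val_lt_one.mp hw (x := algebraMap K F k)).mpr hk1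
  obtain ⟨L, hLfin, hLsep, hLn, hL⟩ := hasSepApprox_of_fg hdw hk0 hk1' E'
    (IntermediateField.essFiniteType_iff.mp inferInstance) (Finset.univ.image e) (by
      intro x hx
      obtain ⟨i, _, rfl⟩ := Finset.mem_image.mp (Finset.mem_coe.mp hx)
      exact ⟨b i, rfl⟩) z hz
  rw [← eq.toLinearEquiv.finrank_eq] at hLn
  choose l hl using fun i ↦ hL (e i) (Finset.mem_image_of_mem e (Finset.mem_univ i))
  have hval : ∀ c : Fin (Module.finrank F E) → K,
      w ((∑ j, c j • l j : L) : Ω) = w (algebraMap E Ω (∑ j, c j • b j)) := by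
    intro c
    by_cases hc : c = 0
    · simp [hc]
    have hcoe : ((∑ j, c j • l j : L) : Ω) = ∑ j, c j • (l j : Ω) := by simp
    have hbe : algebraMap E Ω (∑ j, c j • b j) = ∑ j, algebraMap K F (c j) • e j := by
      rw [map_sum]
      refine Finset.sum_congr rfl fun j _ ↦ ?_
      rw [Algebra.smul_def, Algebra.smul_def, map_mul, ← IsScalarTower.algebraMap_apply K E Ω,
        ← IsScalarTower.algebraMap_apply K F Ω]
    have hs : w (∑ j, algebraMap K F (c j) • e j) ≠ 0 := fun h0 ↦ hc <| funext fun j ↦ by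
      simpa using Fintype.linearIndependent_iff.mp he _ ((Valuation.zero_iff _).mp h0) j
    have hsplit : ∑ j, c j • (l j : Ω) = ∑ j, c j • ((l j : Ω) - e j) +
        ∑ j, algebraMap K F (c j) • e j := by
      rw [← Finset.sum_add_distrib]
      refine Finset.sum_congr rfl fun j _ ↦ ?_
      rw [algebraMap_smul, ← smul_add, sub_add_cancel]
    rw [hcoe, hbe, hsplit]
    refine w.map_add_eq_of_lt_right (w.map_sum_lt hs fun j _ ↦ ?_)
    by_cases hj : c j = 0
    · simpa [hj, zero_lt_iff] using hs
    · refine lt_of_lt_of_le ?_ (hzle (fun j ↦ algebraMap K F (c j)) j)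
      rw [Algebra.smul_def, map_mul, w.map_sub_swap, IsScalarTower.algebraMap_apply K F Ω]
      exact mul_lt_mul_of_pos_left (hl j) (by simpa [zero_lt_iff] using hj)
  have hbK : LinearIndependent K b :=
    b.linearIndependent.restrict_scalars (by
      simpa [Algebra.smul_def] using (algebraMap K F).injective)
  have hlK : LinearIndependent K l := by
    rw [Fintype.linearIndependent_iff]
    intro c hc
    have h1 := hval c
    rw [hc, ZeroMemClass.coe_zero, map_zero, eq_comm, Valuation.zero_iff, map_eq_zero] at h1
    exact Fintype.linearIndependent_iff.mp hbK c h1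
  have hcard : Fintype.card (Fin (Module.finrank F E)) = Module.finrank K L := by
    rw [Fintype.card_fin]
    exact le_antisymm (by simpa using hlK.fintype_card_le_finrank) hLn
  have : Nonempty (Fin (Module.finrank F E)) := ⟨⟨0, Module.finrank_pos⟩⟩
  let bL := basisOfLinearIndependentOfCardEqFinrank hlK hcard
  let φ : L →ₗ[K] E := bL.constr K b
  have hφ : ∀ x : L, w (x : Ω) = w (algebraMap E Ω (φ x)) := by
    intro x
    have h1 : φ x = ∑ j, bL.repr x j • b j := bL.constr_apply_fintype K _ x
    have h2 : x = ∑ j, bL.repr x j • l j := by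
      conv_lhs => rw [← bL.sum_repr x]
      simp [bL]
    rw [h1, ← hval (bL.repr x), ← h2]
  let D : ValuationSubring L := C.comap (algebraMap L Ω)
  have hD : D.comap (algebraMap K L) = A := by
    rw [← hA, ← hCF, ValuationSubring.comap_comap, ValuationSubring.comap_comap,
      ← IsScalarTower.algebraMap_eq, ← IsScalarTower.algebraMap_eq]
  obtain ⟨b', hb'⟩ := exists_valIndep_of_isDefectless hD (hsep L hLfin hLsep D hD)
  have hDw := isEquiv_comap_valuation (A := D) (B := C) (F := L) rfl
  have hBw := isEquiv_comap_valuation hC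
  have hb'' := (hb'.of_le_iff_le (w' := B.valuation) φ (fun x y hxy ↦ by
    rw [← hBw (φ x) (φ y)]
    change w _ ≤ w _
    rw [← hφ, ← hφ]
    exact (hDw x y).mpr hxy) (by
      rw [injective_iff_map_eq_zero]
      intro x hx
      have := hφ x
      rw [hx, map_zero, map_zero, Valuation.zero_iff] at this
      exact_mod_cast this)).of_dense (F := F) hdB
  exact isDefectless_of_valIndep hB hb'' (by rw [Fintype.card_fin, ← hcard, Fintype.card_fin])

end SepDefectlessToCompletion

section SeparablyClosed

open Polynomial IsLocalRing

theorem exists_isRoot_of_coeff_mem_maximalIdeal {R : Type*} [CommRing R] [HenselianLocalRing R]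
    {q : R[X]} (h0 : q.coeff 0 = 1) (h1 : q.coeff 1 = 1)
    (h : ∀ i, 2 ≤ i → q.coeff i ∈ maximalIdeal R) : ∃ x, q.IsRoot x := by
  have hq : 1 ≤ q.natDegree := le_natDegree_of_ne_zero (by rw [h1]; exact one_ne_zero)
  obtain ⟨m, hm⟩ := Nat.exists_eq_add_of_le' hq
  have hmap : q.map (residue R) = 1 + X := by
    ext i
    rw [coeff_map]
    match i with
    | 0 => simp [h0]
    | 1 => simp [h1, coeff_one]
    | i + 2 =>
      rw [(residue_eq_zero_iff _).mpr (h _ (by omega))]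
      simp [coeff_one, coeff_X]
  have hrev : q.reverse.map (residue R) = X ^ (m + 1) + X ^ m := by
    rw [reverse, ← reflect_map, hmap, hm, reflect_add]
    congr 1
    · exact reflect_one _
    · simpa [revAt_le] using reflect_monomial (R := ResidueField R) (m + 1) 1
  have htr : q.natTrailingDegree = 0 := natTrailingDegree_eq_zero.mpr (.inr (by simp [h0]))
  have hmonic : q.reverse.Monic := by
    rw [Monic, reverse_leadingCoeff, trailingCoeff, htr, h0]
  have hz0 : q.reverse.eval (-1) ∈ maximalIdeal R := by
    rw [← residue_eq_zero_iff, ← eval_map_apply, hrev]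
    simp [pow_succ]
  have hz1 : IsUnit (q.reverse.derivative.eval (-1)) := by
    rw [← residue_ne_zero_iff_isUnit, ← eval_map_apply, ← derivative_map, hrev,
      show (X ^ (m + 1) + X ^ m : (ResidueField R)[X]) = X ^ m * (X + 1) by ring, derivative_mul]
    simp
  obtain ⟨z, hz, hz'⟩ := HenselianLocalRing.is_henselian _ hmonic _ hz0 hz1
  have hu : IsUnit z := by
    rw [← residue_ne_zero_iff_isUnit]
    rw [← residue_eq_zero_iff, map_sub, sub_eq_zero] at hz'
    simp [hz']
  let _ := hu.invertible
  refine ⟨⅟z, ?_⟩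
  have := eval₂_reverse_eq_zero_iff (RingHom.id R) (⅟z) q
  simpa [IsRoot, hz.eq_zero, eval₂_id] using this

/-- A henselian field is separably closed in its completion. -/
theorem mem_range_of_isSeparable {K F Γ : Type*} [Field K] [Field F] [Algebra K F]
    [LinearOrderedCommGroupWithZero Γ] [Valued F Γ] {A : ValuationSubring K}
    [HenselianLocalRing A]
    (hA : (Valued.v : Valuation F Γ).valuationSubring.comap (algebraMap K F) = A)
    (hd : ∀ x y : F, y ≠ 0 → ∃ k : K, Valued.v (x - algebraMap K F k) < (Valued.v y : Γ))
    {a : F} (ha : IsSeparable K a) : a ∈ (algebraMap K F).range := by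
  let v : Valuation F Γ := Valued.v
  let f : F[X] := (minpoly K a).map (algebraMap K F)
  have hfa : f.eval a = 0 := by simp [f, eval_map_algebraMap]
  have hfa' : f.derivative.eval a ≠ 0 := by
    simpa [f, derivative_map, eval_map_algebraMap] using
      Separable.aeval_derivative_ne_zero ha (minpoly.aeval K a)
  obtain ⟨k, hk⟩ := dvd_iff_isRoot.mpr hfa
  have hka : k.eval a ≠ 0 := by
    rw [hk] at hfa'
    simpa [derivative_mul] using hfa'
  obtain ⟨δ, hδ, hδk⟩ := mem_nhds_iff_exists_lt.mp
    (k.continuous.continuousAt.eventually_ne hka)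
  have hball : ∀ x : F, {y | v (y - x) < v δ} ∈ nhds x := fun x ↦
    mem_nhds_iff_exists_lt.mpr ⟨δ, hδ, subset_rfl⟩
  let c : ℕ → F → F := fun i x ↦ (hasseDeriv i f).eval x
  have hc : ∀ i, ContinuousAt (c i) a := fun i ↦ (hasseDeriv i f).continuous.continuousAt
  have hc0 : c 0 a = 0 := by simpa [c] using hfa
  have hc1 : c 1 a ≠ 0 := by simpa [c] using hfa'
  have h1 : ∀ᶠ x in nhds a, c 1 x ≠ 0 := (hc 1).eventually_ne hc1
  have h2 : ∀ᶠ x in nhds a, v (c 0 x / c 1 x) < v δ := by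
    have := (((hc 0).div (hc 1) hc1).tendsto.eventually (hball _))
    filter_upwards [this] with x hx
    simpa [hc0] using hx
  have h3 : ∀ᶠ x in nhds a, ∀ i ∈ Finset.range (f.natDegree + 1), 2 ≤ i →
      v (c i x * c 0 x ^ (i - 1) / c 1 x ^ i) < 1 := by
    rw [Filter.eventually_all_finset]
    intro i _
    rw [Filter.eventually_imp_distrib_left]
    intro hi
    have hball' : {y | v (y - 0) < v 1} ∈ nhds (0 : F) :=
      mem_nhds_iff_exists_lt.mpr ⟨1, one_ne_zero, subset_rfl⟩
    have : ContinuousAt (fun x ↦ c i x * c 0 x ^ (i - 1) / c 1 x ^ i) a :=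
      ((hc i).mul ((hc 0).pow (i - 1))).div ((hc 1).pow i) (pow_ne_zero i hc1)
    have h0 : c i a * c 0 a ^ (i - 1) / c 1 a ^ i = 0 := by
      rw [hc0, zero_pow (by omega), mul_zero, zero_div]
    rw [ContinuousAt, h0] at this
    filter_upwards [this.eventually hball'] with x hx
    simpa using hx
  obtain ⟨ε, hε, hε'⟩ := mem_nhds_iff_exists_lt.mp ((h1.and (h2.and h3)).and (hball a))
  obtain ⟨b, hb⟩ := hd a ε hε
  rw [Valuation.map_sub_swap] at hb
  obtain ⟨⟨hb1, hb2, hb3⟩, hb4⟩ := hε' hb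
  let t : ℕ → K := fun i ↦ (taylor b (minpoly K a)).coeff i
  have ht : ∀ i, algebraMap K F (t i) = c i (algebraMap K F b) := fun i ↦ by
    simp only [t, c, f, ← taylor_coeff]
    rw [← map_taylor, coeff_map]
  suffices h : ∃ x : K, (minpoly K a).eval x = 0 ∧ v (algebraMap K F x - algebraMap K F b) < v δ by
    obtain ⟨x, hx, hxb⟩ := h
    refine ⟨x, ?_⟩
    by_contra hxa
    have hxδ : v (algebraMap K F x - a) < v δ := by
      rw [← sub_add_sub_cancel _ (algebraMap K F b)]
      exact v.map_add_lt hxb hb4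
    have h0 : f.eval (algebraMap K F x) = 0 := by
      simp [f, eval_map_algebraMap, aeval_algebraMap_apply, hx]
    rw [hk, eval_mul, mul_eq_zero] at h0
    rcases h0 with h0 | h0
    · exact hxa (by simpa [sub_eq_zero] using h0)
    · exact hδk hxδ h0
  by_cases ht0 : t 0 = 0
  · refine ⟨b, by simpa [t] using ht0, ?_⟩
    simpa [zero_lt_iff] using hδ
  have ht1 : t 1 ≠ 0 := fun h ↦ hb1 (by rw [← ht, h, map_zero])
  let q : K[X] := C (t 0)⁻¹ * (taylor b (minpoly K a)).comp (C (t 0 / t 1) * X)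
  have hq : ∀ i, q.coeff i = (t 0)⁻¹ * (t i * (t 0 / t 1) ^ i) := fun i ↦ by
    simp [q, t, comp_C_mul_X_coeff]
  have hmem : ∀ x : K, v (algebraMap K F x) ≤ 1 ↔ x ∈ A := fun x ↦ by
    rw [← hA]; rfl
  have hq2 : ∀ i, 2 ≤ i → v (algebraMap K F (q.coeff i)) < 1 := fun i hi ↦ by
    by_cases hin : i ∈ Finset.range (f.natDegree + 1)
    · convert hb3 i hin hi using 2
      rw [← ht, ← ht, ← ht, hq]
      obtain ⟨j, rfl⟩ := Nat.exists_eq_add_of_le' hi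
      rw [← map_pow, ← map_mul, ← map_pow, ← map_div₀]
      congr 1
      rw [show j + 2 - 1 = j + 1 by omega, div_pow]
      field_simp
      ring
    · have : t i = 0 := coeff_eq_zero_of_natDegree_lt (by
        rw [natDegree_taylor]
        simpa [f] using hin)
      rw [hq, this]
      simp
  have hq0 : q.coeff 0 = 1 := by simp [hq, ht0]
  have hq1 : q.coeff 1 = 1 := by rw [hq]; field_simp
  have hqA : ∀ i, q.coeff i ∈ A := fun i ↦ by
    match i with
    | 0 => rw [hq0]; exact one_mem A
    | 1 => rw [hq1]; exact one_mem A
    | i + 2 => exact (hmem _).mp (hq2 _ (by omega)).le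
  have hlift : q ∈ lifts A.subtype := by
    rw [lifts_iff_coeff_lifts]
    exact fun i ↦ ⟨⟨_, hqA i⟩, rfl⟩
  obtain ⟨Q, hQ⟩ := hlift
  rw [coe_mapRingHom] at hQ
  have hQc : ∀ i, (Q.coeff i : K) = q.coeff i := fun i ↦ by rw [← hQ, coeff_map]; rfl
  obtain ⟨x, hx⟩ := exists_isRoot_of_coeff_mem_maximalIdeal (q := Q)
    (Subtype.ext (by rw [hQc, hq0]; rfl)) (Subtype.ext (by rw [hQc, hq1]; rfl)) (fun i hi ↦ by
      rw [A.valuation_lt_one_iff, hQc,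
        ← Valuation.isEquiv_iff_val_lt_one.mp (isEquiv_comap_valuation hA)]
      exact (Valuation.isEquiv_iff_val_lt_one.mp v.isEquiv_valuation_valuationSubring).mp
        (hq2 i hi))
  have hqx : q.eval (x : K) = 0 := by
    rw [← hQ, eval_map, ← A.subtype_apply, eval₂_at_apply, hx.eq_zero, map_zero]
  refine ⟨t 0 / t 1 * x + b, ?_, ?_⟩
  · simpa [q, ht0, taylor_eval] using hqx
  · rw [← map_sub, add_sub_cancel_right, map_mul, map_mul, map_div₀, ht, ht]
    exact (mul_le_of_le_one_right' ((hmem _).mpr x.2)).trans_lt hb2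

end SeparablyClosed

section CompletionToSepDefectless

open Polynomial

theorem natDegree_minpoly_le_of_isSeparable {K F M : Type*} [Field K] [Field F] [Field M]
    [Algebra K F] [Algebra K M] [Algebra F M] [IsScalarTower K F M]
    (hs : ∀ x : F, IsSeparable K x → x ∈ (algebraMap K F).range) {a : M} (ha : IsSeparable K a) :
    (minpoly K a).natDegree ≤ (minpoly F a).natDegree := by
  let U := AlgebraicClosure M
  have haF : IsIntegral F a := ha.isIntegral.tower_top
  let g : U[X] := (minpoly F a).map (algebraMap F U)
  have hg : g.Monic := (minpoly.monic haF).map _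
  have hlift : g ∈ lifts (algebraMap (separableClosure K U) U) := by
    refine (IsAlgClosed.splits g).mem_lift_of_roots_mem_range hg _ fun r hr ↦ ?_
    refine ⟨⟨r, mem_separableClosure_iff.mpr ?_⟩, rfl⟩
    have hr0 : aeval r (minpoly F a) = 0 := by
      simpa [g, eval_map_algebraMap] using isRoot_of_mem_roots hr
    refine ha.of_dvd (minpoly.dvd K r ?_)
    obtain ⟨k, hk⟩ := minpoly.dvd_map_of_isScalarTower K F a
    rw [← aeval_map_algebraMap F, hk, map_mul, hr0, zero_mul]
  have hlift' : minpoly F a ∈ lifts (algebraMap K F) := by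
    rw [lifts_iff_coeff_lifts] at hlift ⊢
    intro n
    obtain ⟨s, hs'⟩ := hlift n
    refine hs _ ?_
    rw [coeff_map] at hs'
    have : IsSeparable K (algebraMap F U ((minpoly F a).coeff n)) := by
      rw [← hs']
      exact mem_separableClosure_iff.mp s.2
    rwa [IsSeparable, minpoly.algebraMap_eq (algebraMap F U).injective] at this
  obtain ⟨g₀, hg₀, hdeg, hmon⟩ := lifts_and_natDegree_eq_and_monic hlift' (minpoly.monic haF)
  rw [← hdeg]
  refine natDegree_le_of_dvd (minpoly.dvd K a ?_) hmon.ne_zero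
  rw [← aeval_map_algebraMap F, hg₀, minpoly.aeval]

open IntermediateField in
theorem isDefectless_comap_of_isDefectlessField {K F L Ω : Type u} {Γ : Type v} [Field K]
    [Field F] [Field L] [Field Ω] [Algebra K F] [Algebra K L] [Algebra F Ω] [Algebra L Ω]
    [Algebra K Ω] [IsScalarTower K F Ω] [IsScalarTower K L Ω] [FiniteDimensional K L]
    [Algebra.IsSeparable K L] [LinearOrderedCommGroupWithZero Γ] [Valued F Γ]
    {A : ValuationSubring K} [HenselianLocalRing A]
    (hA : (Valued.v : Valuation F Γ).valuationSubring.comap (algebraMap K F) = A)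
    (hd : ∀ x y : F, y ≠ 0 → ∃ k : K, Valued.v (x - algebraMap K F k) < (Valued.v y : Γ))
    {C : ValuationSubring Ω}
    (hC : C.comap (algebraMap F Ω) = (Valued.v : Valuation F Γ).valuationSubring)
    (hdC : ∀ x : Ω, x ≠ 0 → ∃ l : L, C.valuation (algebraMap L Ω l - x) < C.valuation x)
    (h : IsDefectlessField (Valued.v : Valuation F Γ).valuationSubring) :
    IsDefectless A (C.comap (algebraMap L Ω)) := by
  obtain ⟨a, ha⟩ := Field.exists_primitive_element K L
  have hsep : IsSeparable K a := Algebra.IsSeparable.isSeparable K a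
  let α := algebraMap L Ω a
  have hmin : minpoly K α = minpoly K a := minpoly.algebraMap_eq (algebraMap L Ω).injective a
  have hsepα : IsSeparable K α := by rwa [IsSeparable, hmin]
  have hint : IsIntegral F α := hsepα.isIntegral.tower_top
  let E := F⟮α⟯
  have : FiniteDimensional F E := adjoin.finiteDimensional hint
  have hn : Module.finrank K L ≤ Module.finrank F E := by
    have h1 := natDegree_minpoly_le_of_isSeparable
      (fun x hx ↦ mem_range_of_isSeparable hA hd hx) hsepα
    rwa [hmin, ← adjoin.finrank hsep.isIntegral, ha, finrank_top', ← adjoin.finrank hint] at h1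
  let D := C.comap (algebraMap E Ω)
  have hD : D.comap (algebraMap F E) = (Valued.v : Valuation F Γ).valuationSubring := by
    rw [ValuationSubring.comap_comap, ← IsScalarTower.algebraMap_eq, hC]
  obtain ⟨e, he⟩ := exists_valIndep_of_isDefectless hD (h E this D hD)
  have hDC := isEquiv_comap_valuation (A := D) (B := C) rfl
  have heC : ValIndep F C.valuation fun i ↦ (e i : Ω) :=
    he.of_le_iff_le (IsScalarTower.toAlgHom F E Ω).toLinearMap
      (fun x y hxy ↦ (hDC x y).mpr hxy) (algebraMap E Ω).injective
  choose l hl using fun i ↦ hdC (e i) (heC.1 i)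
  have hlC := heC.of_sub_lt hl
  have hLC := isEquiv_comap_valuation (A := C.comap (algebraMap L Ω)) (B := C) rfl
  have hlK : ValIndep K (C.comap (algebraMap L Ω)).valuation l := by
    refine ⟨fun i hi ↦ hlC.1 i (by simp [hi]), fun c i ↦ (hLC _ _).mp ?_⟩
    have := hlC.2 (fun j ↦ algebraMap K F (c j)) i
    simpa only [Valuation.comap_apply, map_sum, Algebra.smul_def, map_mul,
      ← IsScalarTower.algebraMap_apply] using this
  refine isDefectless_of_valIndep ?_ hlK (le_antisymm hlK.linearIndependent.fintype_card_le_finrank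
    (by rwa [Fintype.card_fin]))
  rw [ValuationSubring.comap_comap, ← IsScalarTower.algebraMap_eq, IsScalarTower.algebraMap_eq K F Ω,
    ← ValuationSubring.comap_comap, hC, hA]

end CompletionToSepDefectless

section Completion

open UniformSpace

variable {F Γ : Type*} [Field F] [LinearOrderedCommGroupWithZero Γ] [Valued F Γ]

theorem exists_sub_algebraMap_lt_completion (x y : Completion F) (hy : y ≠ 0) :
    ∃ k : F, Valued.v (x - algebraMap F (Completion F) k) < (Valued.v y : Γ) := by
  obtain ⟨k, hk⟩ := Completion.denseRange_coe.exists_mem_open isOpen_interior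
    ⟨x, mem_interior_iff_mem_nhds.mpr (mem_nhds_iff_exists_lt.mpr ⟨y, hy, subset_rfl⟩)⟩
  refine ⟨k, ?_⟩
  rw [Valuation.map_sub_swap]
  have := interior_subset hk
  exact this

theorem comap_algebraMap_completion :
    (Valued.v : Valuation (Completion F) Γ).valuationSubring.comap
      (algebraMap F (Completion F)) = (Valued.v : Valuation F Γ).valuationSubring := by
  ext x
  change Valued.v (x : Completion F) ≤ 1 ↔ Valued.v x ≤ 1
  rw [Valued.valuedCompletion_apply]

theorem continuous_of_comap_eq {M Γ' : Type*} [Field M] [Algebra F M]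
    [Algebra.IsAlgebraic F M] [LinearOrderedCommGroupWithZero Γ'] [Valued M Γ']
    (h : (Valued.v : Valuation M Γ').valuationSubring.comap (algebraMap F M) =
      (Valued.v : Valuation F Γ).valuationSubring) : Continuous (algebraMap F M) := by
  refine continuous_of_continuousAt_zero (algebraMap F M) ?_
  rw [ContinuousAt, map_zero]
  intro s hs
  obtain ⟨d, hd, hds⟩ := mem_nhds_iff_exists_lt.mp hs
  obtain ⟨c, hc, hcd⟩ := exists_valuation_algebraMap_le (F := F) Valued.v hd
  refine mem_nhds_iff_exists_lt.mpr ⟨c, hc, fun y hy ↦ hds ?_⟩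
  have h1 := (((Valued.v : Valuation M Γ').isEquiv_valuation_valuationSubring).comap
    (algebraMap F M)).trans (isEquiv_comap_of_comap_eq h)
  have h2 := (Valuation.isEquiv_iff_val_lt_val.mp h1 (x := y) (y := c)).mpr (by simpa using hy)
  rw [Set.mem_ofPred_eq, sub_zero]
  exact lt_of_lt_of_le h2 hcd

theorem comap_mapRingHom_completion {M Γ' : Type*} [Field M] [Algebra F M]
    [LinearOrderedCommGroupWithZero Γ'] [Valued M Γ']
    (h : (Valued.v : Valuation M Γ').valuationSubring.comap (algebraMap F M) =
      (Valued.v : Valuation F Γ).valuationSubring) (hc : Continuous (algebraMap F M)) :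
    (Valued.v : Valuation (Completion M) Γ').valuationSubring.comap
      (Completion.mapRingHom (algebraMap F M) hc) =
      (Valued.v : Valuation (Completion F) Γ).valuationSubring := by
  have hU := (Valued.isClopen_valuationSubring (Γ₀ := Γ') (Completion M)).preimage
    (Completion.continuous_map (f := algebraMap F M))
  have hV := Valued.isClopen_valuationSubring (Γ₀ := Γ) (Completion F)
  ext x
  induction x using Completion.induction_on with
  | hp =>
    convert (hU.inter hV).isClosed.union (hU.compl.inter hV.compl).isClosed using 1
    ext x
    simp only [Set.mem_ofPred_eq, Set.mem_union, Set.mem_inter_iff, Set.mem_compl_iff]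
    exact iff_iff_and_or_not_and_not
  | ih a =>
    rw [ValuationSubring.mem_comap, Completion.mapRingHom_coe]
    change (algebraMap M (Completion M) (algebraMap F M a)) ∈ _ ↔ algebraMap F (Completion F) a ∈ _
    rw [← ValuationSubring.mem_comap, comap_algebraMap_completion, ← ValuationSubring.mem_comap, h,
      ← ValuationSubring.mem_comap, comap_algebraMap_completion]

theorem isDefectless_of_isDefectlessField_completion {K L : Type u} {Γ : Type v} [Field K] [Field L]
    [Algebra K L] [LinearOrderedCommGroupWithZero Γ] [Valued K Γ] [FiniteDimensional K L]
    [Algebra.IsSeparable K L]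
    [HenselianLocalRing (Valued.v : Valuation K Γ).valuationSubring]
    (h : IsDefectlessField (Valued.v : Valuation (Completion K) Γ).valuationSubring)
    {B : ValuationSubring L}
    (hB : B.comap (algebraMap K L) = (Valued.v : Valuation K Γ).valuationSubring) :
    IsDefectless (Valued.v : Valuation K Γ).valuationSubring B := by
  let _ : Valued L B.ValueGroup := Valued.mk' B.valuation
  have hBv : (Valued.v : Valuation L B.ValueGroup).valuationSubring = B :=
    B.valuationSubring_valuation
  have hvB : (Valued.v : Valuation L B.ValueGroup).valuationSubring.comap (algebraMap K L) =
      (Valued.v : Valuation K Γ).valuationSubring := by rw [hBv, hB]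
  have hc := continuous_of_comap_eq hvB
  let _ : Algebra (Completion K) (Completion L) :=
    (Completion.mapRingHom (algebraMap K L) hc).toAlgebra
  let _ : Algebra K (Completion L) :=
    ((algebraMap L (Completion L)).comp (algebraMap K L)).toAlgebra
  have : @IsScalarTower K L (Completion L) _ Algebra.toSMul Algebra.toSMul :=
    .of_algebraMap_eq fun _ ↦ rfl
  have : @IsScalarTower K (Completion K) (Completion L) Algebra.toSMul Algebra.toSMul
      Algebra.toSMul :=
    .of_algebraMap_eq fun x ↦ (Completion.mapRingHom_coe hc x).symm
  have := isDefectless_comap_of_isDefectlessField (K := K) (F := Completion K) (L := L)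
    (Ω := Completion L) comap_algebraMap_completion exists_sub_algebraMap_lt_completion
    (comap_mapRingHom_completion hvB hc) (fun x hx ↦ by
      obtain ⟨l, hl⟩ := exists_sub_algebraMap_lt_completion x x hx
      refine ⟨l, ?_⟩
      rw [Valuation.map_sub_swap]
      exact (Valuation.isEquiv_iff_val_lt_val.mp Valued.v.isEquiv_valuation_valuationSubring).mp hl)
    h
  rwa [comap_algebraMap_completion, hBv] at this

end Completion

/-- A henselian valued field of characteristic `p > 0` is a separably defectless field if and
only if its completion is a defectless field. -/
theorem statement8 {K : Type u} [Field K] {Γ₀ : Type v} [LinearOrderedCommGroupWithZero Γ₀]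
    [hv : Valued K Γ₀] (p : ℕ) (hp : 0 < p) [CharP K p]
    [HenselianLocalRing (Valued.v : Valuation K Γ₀).valuationSubring] :
    IsSepDefectlessField (Valued.v : Valuation K Γ₀).valuationSubring ↔
      IsDefectlessField (Valued.v : Valuation (UniformSpace.Completion K) Γ₀).valuationSubring := by
  constructor
  · intro h E _ _ _ B hB
    let F := UniformSpace.Completion K
    let _ : Algebra K E := ((algebraMap F E).comp (algebraMap K F)).toAlgebra
    have : IsScalarTower K F E := .of_algebraMap_eq fun _ ↦ rfl
    have : IsScalarTower K F (AlgebraicClosure E) := .of_algebraMap_eq fun _ ↦ rfl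
    have : Algebra.IsAlgebraic F (AlgebraicClosure E) := .trans F E _
    exact isDefectless_of_isSepDefectlessField (Ω := AlgebraicClosure E)
      exists_sub_algebraMap_lt_completion comap_algebraMap_completion h hB
  · intro h L _ _ _ _ B hB
    exact isDefectless_of_isDefectlessField_completion h hB

end ValuedDefect
end
end

section
/- Let (K,v) be a valued field of characteristic p>0 and let (K(θ)|K,v) be an Artin-Schreier extension with Artin-Schreier generator θ (so θ^p − θ = a ∈ K and θ ∉ K) which has non-trivial defect, i.e., v extends uniquely from K to K(θ) and the extension (K(θ)|K,v) is immediate. Then v(θ − c) < 0 for every c ∈ K. -/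
open scoped Classical

noncomputable section

namespace ValuedDefect

universe u v

variable {K : Type u} {L : Type v} [Field K] [Field L]

/-- If `θ` generates `L` over `K`, of degree `p = char K`, and `θ ^ p - θ ∈ K`, then
`θ ↦ θ + 1` extends to a `K`-endomorphism of `L`. -/
theorem exists_algHom_apply_eq_add_one [Algebra K L] {p : ℕ} (hp : 0 < p) [CharP K p]
    {θ : L} (hgen : IntermediateField.adjoin K {θ} = ⊤) (hdeg : Module.finrank K L = p)
    (ha : θ ^ p - θ ∈ (algebraMap K L).range) :
    ∃ σ : L →ₐ[K] L, σ θ = θ + 1 := by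
  have hprime : p.Prime := (CharP.char_is_prime_or_zero K p).resolve_right hp.ne'
  have : Fact p.Prime := ⟨hprime⟩
  have : CharP L p := charP_of_injective_algebraMap (algebraMap K L).injective p
  have : FiniteDimensional K L := Module.finite_of_finrank_pos (hdeg ▸ hp)
  obtain ⟨a, ha⟩ := ha
  have hint : IsIntegral K θ := Algebra.IsIntegral.isIntegral θ
  have hnat : (minpoly K θ).natDegree = p := by
    rw [← hdeg]
    exact (Field.primitive_element_iff_minpoly_natDegree_eq K θ).mp hgen
  have hlow : (Polynomial.X + Polynomial.C a : Polynomial K).degree < p := by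
    rw [Polynomial.degree_X_add_C]
    exact_mod_cast hprime.one_lt
  have hmin : minpoly K θ = Polynomial.X ^ p - (Polynomial.X + Polynomial.C a) := by
    refine (Polynomial.eq_of_monic_of_dvd_of_natDegree_le (minpoly.monic hint)
      (Polynomial.monic_X_pow_sub ?_) (minpoly.dvd K θ ?_) ?_).symm
    · exact hlow
    · simp only [map_sub, map_add, map_pow, Polynomial.aeval_X, Polynomial.aeval_C, ha]
      ring
    · rw [hnat, Polynomial.natDegree_sub_eq_left_of_natDegree_lt] <;> simp [hprime.one_lt]
  have hroot : Polynomial.aeval (θ + 1) (minpoly K θ) = 0 := by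
    simp only [hmin, map_sub, map_add, map_pow, Polynomial.aeval_X, Polynomial.aeval_C, ha,
      add_pow_char, one_pow]
    ring
  let pb := (IntermediateField.adjoin.powerBasis hint).map
    ((IntermediateField.equivOfEq hgen).trans IntermediateField.topEquiv)
  have hpb : pb.gen = θ := rfl
  exact ⟨pb.lift (θ + 1) (by rwa [hpb]), pb.lift_gen _ _⟩

/-- If `(K(θ)|K,v)` is an Artin-Schreier defect extension then `v(θ - c) < 0` for every
`c ∈ K` (multiplicatively: `1 < v(θ - c)`). -/
theorem statement11 {K : Type u} {L : Type v} [Field K] [Field L] [Algebra K L]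
    (p : ℕ) (hp : 0 < p) [CharP K p]
    (θ : L) (hgen : IntermediateField.adjoin K {θ} = ⊤)
    (hdeg : Module.finrank K L = p)
    (ha : θ ^ p - θ ∈ (algebraMap K L).range) (hθ : θ ∉ (algebraMap K L).range)
    (A : ValuationSubring K) (B : ValuationSubring L)
    (hB : B.comap (algebraMap K L) = A)
    (huniq : ∀ B' : ValuationSubring L, B'.comap (algebraMap K L) = A → B' = B)
    (himm : IsImmediate K B) :
    ∀ c : K, 1 < B.valuation (θ - algebraMap K L c) := by
  intro c
  obtain ⟨σ, hσ⟩ := exists_algHom_apply_eq_add_one hp hgen hdeg ha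
  have hσB : B.comap (σ : L →+* L) = B := by
    apply huniq
    rw [← hB]
    ext x
    simp [ValuationSubring.mem_comap]
  by_contra! hle
  obtain ⟨d, hd⟩ := himm.2 _ hle
  set η := θ - algebraMap K L c - algebraMap K L d with hη
  have hη0 : η ≠ 0 := by
    intro h
    refine hθ ⟨c + d, ?_⟩
    rw [map_add]
    linear_combination -(hη.symm.trans h)
  have hση : σ η = η + 1 := by
    rw [hη, map_sub, map_sub, σ.commutes, σ.commutes, hσ]
    ring
  have hlt : B.valuation (η + 1) < 1 := by
    by_contra! hge
    have hmem : η⁻¹ ∈ B.comap (σ : L →+* L) := by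
      rw [ValuationSubring.mem_comap, RingHom.coe_coe, map_inv₀, hση,
        ← ValuationSubring.valuation_le_one_iff, map_inv₀]
      exact inv_le_one_of_one_le₀ hge
    rw [hσB, ← ValuationSubring.valuation_le_one_iff, map_inv₀] at hmem
    have hpos : 0 < B.valuation η := zero_lt_iff.mpr ((Valuation.ne_zero_iff _).mpr hη0)
    exact hmem.not_gt ((one_lt_inv₀ hpos).mpr hd)
  have h1 := B.valuation.map_sub_lt hlt hd
  simp at h1

end ValuedDefect
end
end

section
/- Let (K(z)|K,v) be an extension of valued fields of degree p = char(Kv) such that the extension of v from K to K(z) is unique. If the set v(z−K) = {v(z−c) : c ∈ K} has no maximal element, then the extension (K(z)|K,v) is immediate. -/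
open scoped Classical

noncomputable section

namespace ValuedDefect

universe u v

variable {K : Type u} {L : Type v} [Field K] [Field L]

section Slope

open Filter

variable {ι Γ : Type*} [LinearOrderedCommGroupWithZero Γ]

/-- `F` agrees along the filter `l` with a nonzero monomial of degree `m` in `γ`. -/
def HasSlope (l : Filter ι) (γ F : ι → Γ) (m : ℕ) : Prop :=
  ∃ β : Γ, β ≠ 0 ∧ ∀ᶠ x in l, F x = β * γ x ^ m

variable {l : Filter ι} {γ : ι → Γ}

theorem eventually_lt_monomial_of_lt (hγ : ∀ x, γ x ≠ 0) (hl : ∀ c, ∀ᶠ x in l, γ x < γ c)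
    {β β' : Γ} (hβ' : β' ≠ 0) {i j : ℕ} (hij : i < j) :
    (∀ᶠ x in l, β * γ x ^ i < β' * γ x ^ j) ∨ (∀ᶠ x in l, β' * γ x ^ j < β * γ x ^ i) := by
  obtain ⟨k, rfl⟩ := Nat.exists_eq_add_of_lt hij
  have hsplit : ∀ x, β' * γ x ^ (i + k + 1) = β' * γ x ^ (k + 1) * γ x ^ i := fun x => by
    rw [mul_assoc, ← pow_add]; congr 2; omega
  have hpos : ∀ x, 0 < γ x ^ i := fun x => zero_lt_iff.mpr (pow_ne_zero _ (hγ x))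
  by_cases h : ∃ c, β' * γ c ^ (k + 1) ≤ β
  · obtain ⟨c, hc⟩ := h
    refine Or.inr ((hl c).mono fun x hx => ?_)
    rw [hsplit]
    refine mul_lt_mul_of_pos_right (lt_of_lt_of_le ?_ hc) (hpos x)
    exact mul_lt_mul_of_pos_left (pow_lt_pow_left₀ hx zero_le (Nat.succ_ne_zero k))
      (zero_lt_iff.mpr hβ')
  · push Not at h
    refine Or.inl (Eventually.of_forall fun x => ?_)
    rw [hsplit]
    exact mul_lt_mul_of_pos_right (h x) (hpos x)

theorem eventually_lt_monomial_of_ne (hγ : ∀ x, γ x ≠ 0) (hl : ∀ c, ∀ᶠ x in l, γ x < γ c)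
    {β β' : Γ} (hβ : β ≠ 0) (hβ' : β' ≠ 0) {i j : ℕ} (hij : i ≠ j) :
    (∀ᶠ x in l, β * γ x ^ i < β' * γ x ^ j) ∨ (∀ᶠ x in l, β' * γ x ^ j < β * γ x ^ i) := by
  rcases hij.lt_or_gt with h | h
  · exact eventually_lt_monomial_of_lt hγ hl hβ' h
  · exact (eventually_lt_monomial_of_lt hγ hl hβ h).symm

theorem HasSlope.unique [l.NeBot] (hγ : ∀ x, γ x ≠ 0) (hl : ∀ c, ∀ᶠ x in l, γ x < γ c)
    {F : ι → Γ} {m n : ℕ} (hm : HasSlope l γ F m) (hn : HasSlope l γ F n) : m = n := by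
  obtain ⟨β, hβ, h⟩ := hm
  obtain ⟨β', hβ', h'⟩ := hn
  by_contra hne
  rcases eventually_lt_monomial_of_ne hγ hl hβ hβ' hne with H | H
  all_goals
    obtain ⟨x, h1, h2, h3⟩ := (h.and (h'.and H)).exists
    rw [← h1, ← h2] at h3
    exact lt_irrefl _ h3

theorem HasSlope.mul {F G : ι → Γ} {m n : ℕ} (hm : HasSlope l γ F m) (hn : HasSlope l γ G n) :
    HasSlope l γ (fun x => F x * G x) (m + n) := by
  obtain ⟨β, hβ, h⟩ := hm
  obtain ⟨β', hβ', h'⟩ := hn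
  refine ⟨β * β', mul_ne_zero hβ hβ', ?_⟩
  filter_upwards [h, h'] with x h1 h2
  rw [h1, h2, pow_add, mul_mul_mul_comm]

theorem HasSlope.map_add {R : Type*} [Ring R] (v : Valuation R Γ) (hγ : ∀ x, γ x ≠ 0)
    (hl : ∀ c, ∀ᶠ x in l, γ x < γ c) {f g : ι → R} {m n : ℕ}
    (hm : HasSlope l γ (fun x => v (f x)) m) (hn : HasSlope l γ (fun x => v (g x)) n)
    (hmn : m ≠ n) :
    HasSlope l γ (fun x => v (f x + g x)) m ∨ HasSlope l γ (fun x => v (f x + g x)) n := by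
  obtain ⟨β, hβ, h⟩ := hm
  obtain ⟨β', hβ', h'⟩ := hn
  rcases eventually_lt_monomial_of_ne hγ hl hβ hβ' hmn with H | H
  · refine Or.inr ⟨β', hβ', ?_⟩
    filter_upwards [h, h', H] with x h1 h2 h3
    rw [← h1, ← h2] at h3
    rw [v.map_add_eq_of_lt_right h3, h2]
  · refine Or.inl ⟨β, hβ, ?_⟩
    filter_upwards [h, h', H] with x h1 h2 h3
    rw [← h1, ← h2] at h3
    rw [v.map_add_eq_of_lt_left h3, h1]

theorem exists_eventually_dominant_monomial (hγ : ∀ x, γ x ≠ 0)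
    (hl : ∀ c, ∀ᶠ x in l, γ x < γ c) {s : Finset ℕ} (hs : s.Nonempty) {β : ℕ → Γ}
    (hβ : ∀ i ∈ s, β i ≠ 0) :
    ∃ m ∈ s, ∀ᶠ x in l, ∀ i ∈ s, i ≠ m → β i * γ x ^ i < β m * γ x ^ m := by
  induction hs using Finset.Nonempty.cons_induction with
  | singleton a => exact ⟨a, by simp, by simp⟩
  | cons a s ha hs ih =>
    simp only [Finset.mem_cons, forall_eq_or_imp] at hβ
    obtain ⟨m, hm, H⟩ := ih hβ.2
    have ham : a ≠ m := fun h => ha (h ▸ hm)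
    rcases eventually_lt_monomial_of_ne hγ hl hβ.1 (hβ.2 m hm) ham with h | h
    · refine ⟨m, Finset.mem_cons_of_mem hm, ?_⟩
      filter_upwards [H, h] with x h1 h2
      simpa [Finset.mem_cons, forall_eq_or_imp] using ⟨fun _ => h2, h1⟩
    · refine ⟨a, Finset.mem_cons_self a s, ?_⟩
      filter_upwards [H, h] with x h1 h2 i hi hia
      have his : i ∈ s := (Finset.mem_cons.mp hi).resolve_left hia
      by_cases him : i = m
      · exact him ▸ h2
      · exact (h1 i his him).trans h2

end Slope

section Polynomial

open Filter Polynomial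

variable {ι R Γ : Type*} [CommRing R] [LinearOrderedCommGroupWithZero Γ] {l : Filter ι}

theorem exists_eventually_dominant_taylor [IsDomain R] (v : Valuation R Γ)
    (hv : ∀ r, v r = 0 → r = 0) {z : R} {a : ι → R}
    (hγ : ∀ x, v (a x - z) ≠ 0) (hl : ∀ c, ∀ᶠ x in l, v (a x - z) < v (a c - z))
    {g : R[X]} (hg : g ≠ 0) :
    ∃ m ≤ g.natDegree, (taylor z g).coeff m ≠ 0 ∧ ∀ᶠ x in l,
      v (g.eval (a x) - (taylor z g).coeff m * (a x - z) ^ m) <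
        v ((taylor z g).coeff m) * v (a x - z) ^ m := by
  have ht : taylor z g ≠ 0 := by simpa using hg
  obtain ⟨m, hm, H⟩ := exists_eventually_dominant_monomial hγ hl
    (s := (taylor z g).support) (by simpa using hg)
    (β := fun i => v ((taylor z g).coeff i))
    (fun i hi h => (mem_support_iff.mp hi) (hv _ h))
  refine ⟨m, ?_, mem_support_iff.mp hm, ?_⟩
  · simpa using le_natDegree_of_mem_supp m hm
  filter_upwards [H] with x hx
  have hpos : v ((taylor z g).coeff m) * v (a x - z) ^ m ≠ 0 :=
    mul_ne_zero (fun h => mem_support_iff.mp hm (hv _ h)) (pow_ne_zero _ (hγ x))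
  have hsum : g.eval (a x) = ∑ i ∈ (taylor z g).support,
      (taylor z g).coeff i * (a x - z) ^ i := by
    rw [← taylor_eval_sub z g, eval_eq_sum, Polynomial.sum]
  rw [hsum, ← Finset.add_sum_erase _ _ hm, add_sub_cancel_left]
  refine v.map_sum_lt hpos fun i hi => ?_
  rw [map_mul, map_pow]
  exact hx i (Finset.mem_of_mem_erase hi) (Finset.ne_of_mem_erase hi)

end Polynomial

section UniqueExtension

theorem isIntegral_of_forall_comap_eq {K L : Type*} [Field K] [Field L] [Algebra K L]
    (A : ValuationSubring K) {x : L}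
    (hx : ∀ V : ValuationSubring L, V.comap (algebraMap K L) = A → x ∈ V) :
    IsIntegral A x := by
  by_contra hxA
  have hx0 : x ≠ 0 := by rintro rfl; exact hxA isIntegral_zero
  let := invertibleOfNonzero hx0
  let S := Algebra.adjoin A {x⁻¹}
  have hne : (IsLocalRing.maximalIdeal A).map (algebraMap A S) +
      .span {⟨x⁻¹, Algebra.subset_adjoin rfl⟩} ≠ ⊤ := fun eq ↦ hxA <| by
    have ⟨p, hp, hpx⟩ :=
      Algebra.exists_aeval_invOf_eq_zero_of_idealMap_adjoin_sup_span_eq_top _ _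
        (IsLocalRing.maximalIdeal.isMaximal A).ne_top eq
    have H : IsUnit p.leadingCoeff := of_not_not fun h ↦ by simpa using sub_mem h hp
    exact ⟨.C H.unit⁻¹.1 * p, by simp [Polynomial.Monic], by
      rw [← Polynomial.aeval_def, map_mul, show x = ⅟(x⁻¹) by simp, hpx, mul_zero]⟩
  obtain ⟨V, hSV, hV⟩ := Ideal.image_subset_nonunits_valuationSubring (A := S.toSubring) _ hne
  have hAV : V.comap (algebraMap K L) = A := by
    ext a
    rw [ValuationSubring.mem_comap]
    refine ⟨fun ha => ?_, fun ha => hSV (S.algebraMap_mem ⟨a, ha⟩)⟩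
    by_contra haA
    have ha0 : a ≠ 0 := by rintro rfl; exact haA A.zero_mem
    have hinv : a⁻¹ ∈ A.nonunits := A.inv_mem_nonunits_iff.mpr (Or.inr haA)
    obtain ⟨h, hmax⟩ := A.mem_nonunits_iff_exists_mem_maximalIdeal.mp hinv
    have hmem : (algebraMap K L a)⁻¹ ∈ V.nonunits := by
      rw [← map_inv₀]
      exact hV ⟨_, le_self_add (α := Ideal S) (Ideal.mem_map_of_mem _ hmax), rfl⟩
    rcases V.inv_mem_nonunits_iff.mp hmem with h0 | h0
    · exact ha0 (by simpa using h0)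
    · exact h0 ha
  refine (V.inv_mem_nonunits_iff.mp ?_).resolve_left hx0 (hx V hAV)
  exact hV ⟨_, le_add_self (α := Ideal S) (Ideal.subset_span rfl), rfl⟩

theorem exists_valuation_pow_eq {K L Γ : Type*} [Field K] [Field L] [Algebra K L]
    [LinearOrderedCommGroupWithZero Γ] (v : Valuation L Γ) {x : L} (hx0 : x ≠ 0)
    (hx : IsAlgebraic K x) :
    ∃ n > 0, ∃ c : K, c ≠ 0 ∧ v x ^ n = v (algebraMap K L c) := by
  obtain ⟨q, hq, hqx⟩ := hx
  by_contra! H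
  have hvx : v x ≠ 0 := (Valuation.ne_zero_iff _).mpr hx0
  have hlt : ∀ i ∈ q.support, ∀ j ∈ q.support, i < j →
      v (algebraMap K L (q.coeff i) * x ^ i) ≠ v (algebraMap K L (q.coeff j) * x ^ j) := by
    intro i hi j hj hij heq
    rw [Polynomial.mem_support_iff] at hi hj
    refine H (j - i) (Nat.sub_pos_of_lt hij) (q.coeff i / q.coeff j) (div_ne_zero hi hj) ?_
    have hj' : v (algebraMap K L (q.coeff j)) ≠ 0 := by simpa using hj
    rw [map_div₀, map_div₀, eq_div_iff hj']
    simp only [map_mul, map_pow] at heq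
    rw [← pow_sub_mul_pow (v x) hij.le, ← mul_assoc] at heq
    rw [mul_comm]
    exact (mul_right_cancel₀ (pow_ne_zero i hvx) heq).symm
  obtain ⟨m, hm, hmax⟩ := q.support.exists_max_image
    (fun i => v (algebraMap K L (q.coeff i) * x ^ i)) (by simpa using hq)
  have hsum : v (∑ i ∈ q.support, algebraMap K L (q.coeff i) * x ^ i) =
      v (algebraMap K L (q.coeff m) * x ^ m) := by
    classical
    refine v.map_sum_eq_of_lt hm fun i hi => ?_
    rw [Finset.mem_sdiff, Finset.mem_singleton] at hi
    refine lt_of_le_of_ne (hmax i hi.1) ?_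
    rcases Ne.lt_or_gt hi.2 with h | h
    · exact hlt i hi.1 m hm h
    · exact (hlt m hm i hi.1 h).symm
  rw [Polynomial.aeval_eq_sum_range] at hqx
  have hqx' : ∑ i ∈ q.support, algebraMap K L (q.coeff i) * x ^ i = 0 := by
    rw [← hqx]
    simp_rw [Algebra.smul_def]
    refine Finset.sum_subset Polynomial.supp_subset_range_natDegree_succ fun i _ hi => ?_
    rw [Polynomial.notMem_support_iff.mp hi, map_zero, zero_mul]
  rw [hqx', map_zero] at hsum
  have := Polynomial.mem_support_iff.mp hm
  simp_all

theorem valuation_norm_eq_pow {K L : Type*} [Field K] [Field L] [Algebra K L]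
    [FiniteDimensional K L] (B : ValuationSubring L)
    (huniq : ∀ B' : ValuationSubring L,
      B'.comap (algebraMap K L) = B.comap (algebraMap K L) → B' = B) (x : L) :
    B.valuation (algebraMap K L (Algebra.norm K x)) = B.valuation x ^ Module.finrank K L := by
  have hpos : Module.finrank K L ≠ 0 := Module.finrank_pos.ne'
  obtain rfl | hx0 := eq_or_ne x 0
  · simp [hpos]
  have hle : ∀ y : L, B.valuation y ≤ 1 → B.valuation (algebraMap K L (Algebra.norm K y)) ≤ 1 := by
    intro y hy
    have hint : IsIntegral (B.comap (algebraMap K L)) y :=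
      isIntegral_of_forall_comap_eq _ fun V hV => by
        rw [huniq V hV]; exact (B.valuation_le_one_iff y).mp hy
    obtain ⟨a, ha⟩ := IsIntegrallyClosed.isIntegral_iff.mp (Algebra.isIntegral_norm K hint)
    rw [ValuationSubring.valuation_le_one_iff, ← ha]
    exact a.2
  obtain ⟨n, hn, c, hc, hxc⟩ := exists_valuation_pow_eq B.valuation hx0
    (Algebra.IsAlgebraic.isAlgebraic (R := K) x)
  have hc' : B.valuation (algebraMap K L c) ≠ 0 := by simpa using hc
  have hu : B.valuation (x ^ n / algebraMap K L c) = 1 := by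
    rw [map_div₀, map_pow, hxc, div_self hc']
  set u := x ^ n / algebraMap K L c with hu_def
  have hu0 : u ≠ 0 := (Valuation.ne_zero_iff _).mp (hu ▸ one_ne_zero)
  have hN : B.valuation (algebraMap K L (Algebra.norm K u)) = 1 := by
    refine le_antisymm (hle u hu.le) ?_
    have hinv := hle u⁻¹ (by rw [map_inv₀, hu, inv_one])
    have hmul : B.valuation (algebraMap K L (Algebra.norm K u)) *
        B.valuation (algebraMap K L (Algebra.norm K u⁻¹)) = 1 := by
      rw [← map_mul, ← map_mul, ← map_mul, mul_inv_cancel₀ hu0, map_one, map_one, map_one]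
    rw [← hmul]
    exact mul_le_of_le_one_right' hinv
  have hcL : algebraMap K L c ≠ 0 := by simpa using hc
  have hnorm : Algebra.norm K u * c ^ Module.finrank K L = Algebra.norm K x ^ n := by
    rw [← Algebra.norm_algebraMap, ← map_mul, hu_def, div_mul_cancel₀ _ hcL, map_pow]
  have hval := congrArg (fun y => B.valuation (algebraMap K L y)) hnorm
  simp only [map_mul, map_pow, hN, one_mul] at hval
  rw [← hxc, ← pow_mul, mul_comm, pow_mul] at hval
  exact ((pow_left_inj₀ zero_le zero_le hn.ne').mp hval).symm

end UniqueExtension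

section Approximation

open Filter Polynomial

variable {K L Γ : Type*} [Field K] [Field L] [Algebra K L] [LinearOrderedCommGroupWithZero Γ]
  {l : Filter K} {v : Valuation L Γ} {z : L}

theorem exists_polynomial_slope (hγ : ∀ c, v (algebraMap K L c - z) ≠ 0)
    (hl : ∀ c, ∀ᶠ x in l, v (algebraMap K L x - z) < v (algebraMap K L c - z))
    {g : K[X]} (hg : g ≠ 0) :
    ∃ m ≤ g.natDegree, HasSlope l (fun c => v (algebraMap K L c - z))
        (fun c => v (algebraMap K L (g.eval c))) m ∧
      (m = 0 → ∀ᶠ c in l, v (algebraMap K L (g.eval c) - aeval z g) < v (aeval z g)) := by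
  have hg' : g.map (algebraMap K L) ≠ 0 :=
    (Polynomial.map_ne_zero_iff (algebraMap K L).injective).mpr hg
  obtain ⟨m, hm, hb, H⟩ := exists_eventually_dominant_taylor v
    (fun r => (Valuation.zero_iff v).mp) hγ hl hg'
  rw [natDegree_map] at hm
  simp only [eval_map_algebraMap, aeval_algebraMap_apply, coe_aeval_eq_eval] at H
  refine ⟨m, hm, ⟨_, (Valuation.ne_zero_iff v).mpr hb, H.mono fun c hc => ?_⟩, ?_⟩
  · rw [← map_pow, ← map_mul] at hc ⊢
    exact v.map_eq_of_sub_lt hc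
  · rintro rfl
    simpa [taylor_coeff_zero, eval_map_algebraMap] using H

theorem slope_eq_zero_of_natDegree_lt [l.NeBot] (hγ : ∀ c, v (algebraMap K L c - z) ≠ 0)
    (hl : ∀ c, ∀ᶠ x in l, v (algebraMap K L x - z) < v (algebraMap K L c - z))
    {f : K[X]} (hf : f.natDegree.Prime)
    (hfs : HasSlope l (fun c => v (algebraMap K L c - z))
      (fun c => v (algebraMap K L (f.eval c))) f.natDegree)
    {g : K[X]} (hg : g ≠ 0) (hgf : g.natDegree < f.natDegree) {m : ℕ}
    (hm : HasSlope l (fun c => v (algebraMap K L c - z))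
      (fun c => v (algebraMap K L (g.eval c))) m) : m = 0 := by
  induction hd : g.natDegree using Nat.strong_induction_on generalizing g m with
  | h d ih =>
  subst hd
  by_contra hm0
  have hle : m ≤ g.natDegree := by
    obtain ⟨n, hn, hns, -⟩ := exists_polynomial_slope hγ hl hg
    exact hm.unique hγ hl hns ▸ hn
  have key : ∀ N : ℕ, ∀ q : K[X], q ≠ 0 → q.natDegree = N → ∀ n,
      HasSlope l (fun c => v (algebraMap K L c - z))
        (fun c => v (algebraMap K L (q.eval c))) n →
      ∃ k, n = k * m ∧ k * g.natDegree ≤ N := by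
    intro N
    induction N using Nat.strong_induction_on with
    | h N ihN =>
    intro q hq hqN n hn
    subst hqN
    rcases lt_or_ge q.natDegree g.natDegree with hlt | hge
    · exact ⟨0, by simpa using ih _ hlt hq (hlt.trans hgf) hn rfl, by simp⟩
    have hdeg : g.degree ≤ q.degree := by
      rw [degree_eq_natDegree hg, degree_eq_natDegree hq]
      exact_mod_cast hge
    have hs0 : q / g ≠ 0 := by
      rw [Ne, Polynomial.div_eq_zero_iff hg]
      exact not_lt.mpr hdeg
    have hadd : g.natDegree + (q / g).natDegree = q.natDegree := by
      have := degree_add_div hg hdeg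
      rw [degree_eq_natDegree hg, degree_eq_natDegree hs0, degree_eq_natDegree hq] at this
      exact_mod_cast this
    obtain ⟨n', -, hn', -⟩ := exists_polynomial_slope hγ hl hs0
    obtain ⟨k, rfl, hk⟩ := ihN _ (by omega) (q / g) hs0 rfl n' hn'
    have hmul := hm.mul hn'
    simp only [← map_mul, ← eval_mul] at hmul
    have hres : n = m + k * m ∨ n = 0 := by
      rcases eq_or_ne (q % g) 0 with hr | hr
      · have hq' := EuclideanDomain.div_add_mod q g
        rw [hr, add_zero] at hq'
        rw [hq'] at hmul
        exact Or.inl (hn.unique hγ hl hmul)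
      · obtain ⟨n'', -, hn'', -⟩ := exists_polynomial_slope hγ hl hr
        have hlt : (q % g).natDegree < g.natDegree :=
          natDegree_lt_natDegree hr (degree_mod_lt q hg)
        obtain rfl : n'' = 0 := ih _ hlt hr (hlt.trans hgf) hn'' rfl
        have hsum := hmul.map_add v hγ hl hn'' (by omega)
        simp only [← map_add, ← eval_add, EuclideanDomain.div_add_mod] at hsum
        exact hsum.imp (hn.unique hγ hl) (hn.unique hγ hl)
    rcases hres with rfl | rfl
    · refine ⟨k + 1, by ring, ?_⟩
      rw [add_mul]
      omega
    · exact ⟨0, by simp, by simp⟩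
  obtain ⟨k, hk, hkd⟩ := key _ f (by rintro rfl; simp at hgf) rfl _ hfs
  rcases (Nat.dvd_prime hf).mp (Dvd.intro_left k hk.symm) with h1 | h1
  · subst h1
    rw [mul_one] at hk
    have hg1 : g.natDegree = 1 := by
      refine le_antisymm ?_ hle
      rw [hk] at hkd
      exact Nat.le_of_mul_le_mul_left (by simpa using hkd) (hk ▸ hf.pos)
    obtain ⟨b, hb, c, hc⟩ := natDegree_eq_one.mp hg1
    have hconst : HasSlope l (fun c => v (algebraMap K L c - z))
        (fun c => v (algebraMap K L (g.eval c))) 0 := by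
      refine ⟨v (algebraMap K L b) * v (algebraMap K L (-c / b) - z),
        mul_ne_zero (by simpa using hb) (hγ _), ?_⟩
      filter_upwards [hl (-c / b)] with x hx
      have hx' : algebraMap K L (g.eval x) = algebraMap K L b *
          ((algebraMap K L x - z) - (algebraMap K L (-c / b) - z)) := by
        rw [sub_sub_sub_cancel_right, ← map_sub, ← map_mul, ← hc]
        congr 1
        simp only [eval_add, eval_mul, eval_C, eval_X]
        field_simp
        ring
      rw [pow_zero, mul_one, hx', map_mul, v.map_sub_eq_of_lt_right hx]
    exact hm0 (hm.unique hγ hl hconst)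
  · omega

end Approximation

theorem exists_filter_eventually_lt {ι Γ : Type*} [Nonempty ι] [LinearOrder Γ] {γ : ι → Γ}
    (h : ∀ c, ∃ c', γ c' < γ c) :
    ∃ l : Filter ι, l.NeBot ∧ ∀ c, ∀ᶠ x in l, γ x < γ c := by
  have : NoMinOrder (Set.range γ) := ⟨by
    rintro ⟨_, c, rfl⟩
    obtain ⟨c', hc'⟩ := h c
    exact ⟨⟨γ c', c', rfl⟩, hc'⟩⟩
  refine ⟨Filter.atBot.comap (Set.rangeFactorization γ),
    Filter.atBot_neBot.comap_of_surj Set.rangeFactorization_surjective, fun c => ?_⟩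
  exact Filter.tendsto_comap.eventually (Filter.eventually_lt_atBot (⟨γ c, c, rfl⟩ : Set.range γ))

/-- If `(K(z)|K,v)` has degree `p = char(Kv)`, the extension of `v` is unique, and
`v(z - K)` has no maximal element, then `(K(z)|K,v)` is immediate. -/
theorem statement12 {K : Type u} {L : Type v} [Field K] [Field L] [Algebra K L]
    (p : ℕ) (hp : 0 < p)
    (A : ValuationSubring K) (B : ValuationSubring L)
    (hB : B.comap (algebraMap K L) = A)
    (z : L) (hgen : IntermediateField.adjoin K {z} = ⊤)
    (hdeg : Module.finrank K L = p)
    (hres : p = ringChar (IsLocalRing.ResidueField A))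
    (huniq : ∀ B' : ValuationSubring L, B'.comap (algebraMap K L) = A → B' = B)
    (hnomax : ∀ c : K, ∃ c' : K,
      B.valuation (z - algebraMap K L c') < B.valuation (z - algebraMap K L c)) :
    IsImmediate K B := by
  subst hB
  have hprime : p.Prime := by
    have := ringChar.charP (IsLocalRing.ResidueField (B.comap (algebraMap K L)))
    rw [← hres] at this
    exact (CharP.char_is_prime_or_zero
      (IsLocalRing.ResidueField (B.comap (algebraMap K L))) p).resolve_right hp.ne'
  have : FiniteDimensional K L := Module.finite_of_finrank_pos (hdeg ▸ hp)
  simp only [fun c => B.valuation.map_sub_swap z (algebraMap K L c)] at hnomax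
  have hγ : ∀ c : K, B.valuation (algebraMap K L c - z) ≠ 0 := fun c =>
    ((hnomax c).choose_spec.trans_le' zero_le).ne'
  obtain ⟨l, hne, hl⟩ := exists_filter_eventually_lt hnomax
  have hz : IsIntegral K z := Algebra.IsIntegral.isIntegral z
  have hfp : (minpoly K z).natDegree = p := by
    rw [← IntermediateField.adjoin.finrank hz, hgen, IntermediateField.finrank_top', hdeg]
  have hfs : HasSlope l (fun c => B.valuation (algebraMap K L c - z))
      (fun c => B.valuation (algebraMap K L ((minpoly K z).eval c))) (minpoly K z).natDegree := by
    refine ⟨1, one_ne_zero, Filter.Eventually.of_forall fun c => ?_⟩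
    have hchar : (Algebra.lmul K L z).charpoly = minpoly K z := by
      refine Polynomial.eq_of_monic_of_dvd_of_natDegree_le (minpoly.monic hz)
        (LinearMap.charpoly_monic _) (minpoly.dvd K z ?_) ?_
      · refine Algebra.lmul_injective (R := K) ?_
        rw [← Polynomial.aeval_algHom_apply, map_zero]
        exact LinearMap.aeval_self_charpoly _
      · rw [LinearMap.charpoly_natDegree, hdeg, hfp]
    have heval := (Algebra.lmul K L z).eval_charpoly c
    rw [← AlgHom.commutes (Algebra.lmul K L), ← map_sub, hchar] at heval
    rw [one_mul, hfp, ← hdeg, ← valuation_norm_eq_pow B huniq]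
    exact congrArg (fun y => B.valuation (algebraMap K L y)) heval
  have happrox : ∀ x : L, x ≠ 0 → ∃ c : K,
      B.valuation (algebraMap K L c - x) < B.valuation x := by
    intro x hx
    have hxadj : x ∈ Algebra.adjoin K {z} := by
      rw [← IntermediateField.adjoin_simple_toSubalgebra_of_isAlgebraic hz.isAlgebraic, hgen]
      trivial
    obtain ⟨q, hq⟩ := Algebra.adjoin_mem_exists_aeval K z hxadj
    have hgx : Polynomial.aeval z (q %ₘ minpoly K z) = x := by
      rw [Polynomial.aeval_modByMonic_eq_self_of_root (minpoly.aeval K z), hq]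
    have hg0 : q %ₘ minpoly K z ≠ 0 := by
      intro h
      rw [h, map_zero] at hgx
      exact hx hgx.symm
    have hlt := Polynomial.natDegree_modByMonic_lt q (minpoly.monic hz) (minpoly.ne_one K z)
    obtain ⟨m, -, hm, H⟩ := exists_polynomial_slope hγ hl hg0
    obtain ⟨c, hc⟩ := (H (slope_eq_zero_of_natDegree_lt hγ hl (hfp ▸ hprime) hfs hg0 hlt hm)).exists
    exact ⟨_, hgx ▸ hc⟩
  refine ⟨fun x hx => ?_, fun x hx => ?_⟩
  · obtain ⟨c, hc⟩ := happrox x hx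
    exact ⟨c, (B.valuation.map_eq_of_sub_lt hc).symm⟩
  · obtain rfl | hx0 := eq_or_ne x 0
    · exact ⟨0, by simp⟩
    obtain ⟨c, hc⟩ := happrox x hx0
    exact ⟨c, by rw [Valuation.map_sub_swap]; exact hc.trans_le hx⟩

end ValuedDefect
end
end

section
/- Let (K,v) be a valued field of characteristic p>0 and fix an extension of v to the algebraic closure of K. Assume η is an element of the algebraic closure with η^p ∈ K and η ∉ K such that (K(η)|K,v) is immediate, and assume η does not lie in the completion of K, i.e., there exists γ ∈ vK with v(η−c) < γ for all c ∈ K. Let b ∈ K, b ≠ 0. Then (p−1)·v(b) + v(η) > p·v(η−c) holds for all c ∈ K if and only if there is a root θ (in the algebraic closure) of the polynomial X^p − X − (η/b)^p such that v(θ − η/b) > v(η/b − c) for all c ∈ K; in that case moreover v(θ) = v(η) − v(b), and (K(θ)|K,v) is a dependent Artin-Schreier defect extension. -/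
open scoped Classical

noncomputable section

namespace ValuedDefect

universe u v

variable {K : Type u} {L : Type v} [Field K] [Field L]

section ImmediateApproximation

open Polynomial

variable {K F Γ : Type*} [Field K] [Field F] [Algebra K F]
  [LinearOrderedCommGroupWithZero Γ]

/-- `x` lies closer to `a` than every element of `K`. -/
def IsCloserThanBase (K : Type*) {F Γ : Type*} [Field K] [Field F] [Algebra K F]
    [LinearOrderedCommGroupWithZero Γ] (v : Valuation F Γ) (a x : F) : Prop :=
  ∀ c : K, v (a - x) < v (a - algebraMap K F c)

/-- `a` has no best approximation in `K`. -/
def HasNoBestApprox (K : Type*) {F Γ : Type*} [Field K] [Field F] [Algebra K F]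
    [LinearOrderedCommGroupWithZero Γ] (v : Valuation F Γ) (a : F) : Prop :=
  ∀ c : K, ∃ c' : K, v (a - algebraMap K F c') < v (a - algebraMap K F c)

theorem prod_sub_approx (v : Valuation F Γ) (a : F) (s : Multiset F)
    (hs : ∀ β ∈ s, ¬ IsCloserThanBase K v a β) :
    ∃ c₀ : K, ∀ x : F, v (a - x) < v (a - algebraMap K F c₀) →
      v ((s.map (x - ·)).prod - (s.map (a - ·)).prod) < v ((s.map (a - ·)).prod) := by
  induction s using Multiset.induction with
  | empty => exact ⟨0, fun x _ => by simp⟩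
  | cons β s ih =>
    obtain ⟨c₁, h₁⟩ := ih fun γ hγ => hs γ (Multiset.mem_cons_of_mem hγ)
    have hβ := hs β (Multiset.mem_cons_self β s)
    simp only [IsCloserThanBase, not_forall, not_lt] at hβ
    obtain ⟨c₂, h₂⟩ := hβ
    obtain ⟨c₀, h01, h02⟩ : ∃ c₀ : K, v (a - algebraMap K F c₀) ≤ v (a - algebraMap K F c₁) ∧
        v (a - algebraMap K F c₀) ≤ v (a - algebraMap K F c₂) := by
      rcases le_total (v (a - algebraMap K F c₁)) (v (a - algebraMap K F c₂)) with h | h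
      · exact ⟨c₁, le_rfl, h⟩
      · exact ⟨c₂, h, le_rfl⟩
    refine ⟨c₀, fun x hx => ?_⟩
    have hlt : v (a - x) < v (a - β) := (hx.trans_le h02).trans_le h₂
    have hs' := h₁ x (hx.trans_le h01)
    have hxβ : v (x - β) = v (a - β) := by
      rw [← v.map_sub_eq_of_lt_left hlt]
      congr 1
      ring
    rw [Multiset.map_cons, Multiset.map_cons, Multiset.prod_cons, Multiset.prod_cons, map_mul]
    set P := (s.map (x - ·)).prod
    set Q := (s.map (a - ·)).prod
    have e : (x - β) * P - (a - β) * Q = (x - β) * (P - Q) - (a - x) * Q := by ring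
    rw [e]
    refine v.map_sub_lt ?_ ?_
    · rw [map_mul, hxβ]
      exact mul_lt_mul_of_pos_left hs' (zero_le.trans_lt hlt)
    · rw [map_mul]
      exact mul_lt_mul_of_pos_right hlt (zero_le.trans_lt hs')

theorem valuation_natCast_eq_one {p : ℕ} (hp : p.Prime) [CharP F p] (v : Valuation F Γ)
    {n : ℕ} (hn : 0 < n) (hnp : n < p) : v (n : F) = 1 := by
  have : Fact p.Prime := ⟨hp⟩
  have h0 : (n : ZMod p) ≠ 0 := by
    rw [Ne, ZMod.natCast_eq_zero_iff]
    exact Nat.not_dvd_of_pos_of_lt hn hnp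
  have h1 : (n : F) ^ (p - 1) = 1 := by
    have := congrArg (ZMod.castHom (dvd_refl p) F) (ZMod.pow_card_sub_one_eq_one h0)
    simpa only [map_pow, map_natCast, map_one] using this
  have h2 : v (n : F) ^ (p - 1) = 1 ^ (p - 1) := by rw [← map_pow, h1, map_one, one_pow]
  exact (pow_left_inj₀ zero_le zero_le (Nat.sub_ne_zero_of_lt hp.one_lt)).mp h2

theorem natDegree_minpoly_le_of_mem_aroots {f : K[X]} {β : F} (hβ : β ∈ f.aroots F) :
    (minpoly K β).natDegree ≤ f.natDegree := by
  rw [mem_aroots] at hβ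
  exact natDegree_le_of_dvd (minpoly.dvd K β hβ.2) hβ.1

theorem exists_aeval_eq_of_mem_adjoin {p : ℕ} {x y : F} (hx : IsIntegral K x)
    (hdeg : (minpoly K x).natDegree ≤ p) (hy : y ∈ IntermediateField.adjoin K {x}) :
    ∃ f : K[X], f.natDegree < p ∧ aeval x f = y := by
  rw [← IntermediateField.mem_toSubalgebra,
    IntermediateField.adjoin_simple_toSubalgebra_of_isAlgebraic hx.isAlgebraic,
    Algebra.adjoin_singleton_eq_range_aeval] at hy
  obtain ⟨g, rfl⟩ := hy
  exact ⟨g %ₘ minpoly K x,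
    (natDegree_modByMonic_lt _ (minpoly.monic hx) (minpoly.ne_one K x)).trans_le hdeg,
    aeval_modByMonic_eq_self_of_root (minpoly.aeval K x)⟩

/-- A root of `X ^ p - X - a ^ p` is close to `a` iff `v a < v (a - c) ^ p` for all `c` in `K`. -/
theorem isCloserThanBase_artinSchreier_iff {p : ℕ} (hp : p.Prime) [CharP F p]
    (v : Valuation F Γ) {a θ : F} (ha : a ≠ 0) (hθ : θ ^ p - θ = a ^ p) :
    IsCloserThanBase K v a θ ↔ ∀ c : K, v a < v (a - algebraMap K F c) ^ p := by
  have : Fact p.Prime := ⟨hp⟩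
  have hζ : (θ - a) ^ p - (θ - a) = a := by
    rw [sub_pow_char, ← hθ]
    ring
  have hsw : v (a - θ) = v (θ - a) := v.map_sub_swap a θ
  have hva : 0 < v a := v.pos_iff.mpr ha
  constructor
  · intro h c
    have h0 : v (θ - a) < v a := by simpa [hsw] using h 0
    have h1 : v (θ - a) ^ p = v a := by
      rw [← map_pow, ← v.map_add_eq_of_lt_left h0, sub_eq_iff_eq_add.mp hζ]
    rw [← h1, ← hsw]
    exact pow_lt_pow_left₀ (h c) zero_le hp.ne_zero
  · intro h c
    have ha1 : 1 < v a := by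
      by_contra! hle
      have h0 : v a < v a ^ p := by simpa using h 0
      exact h0.not_ge (pow_le_of_le_one zero_le hle hp.ne_zero)
    have hζ1 : 1 < v (θ - a) := by
      by_contra! hle
      have := v.map_sub_le (x := (θ - a) ^ p) (y := θ - a) (g := 1)
        (by rw [map_pow]; exact pow_le_one₀ zero_le hle) hle
      rw [hζ] at this
      exact this.not_gt ha1
    have hlt : v (θ - a) < v ((θ - a) ^ p) := by
      rw [map_pow]
      exact lt_self_pow₀ hζ1 hp.one_lt
    have h1 : v (θ - a) ^ p = v a := by
      rw [← map_pow, ← v.map_sub_eq_of_lt_left hlt, hζ]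
    rw [hsw]
    exact lt_of_pow_lt_pow_left₀ p zero_le (h1 ▸ h c)

variable [IsAlgClosed F]

theorem aeval_approx (v : Valuation F Γ) (a : F) (f : K[X]) (hf : f ≠ 0)
    (hs : ∀ β ∈ f.aroots F, ¬ IsCloserThanBase K v a β) :
    ∃ c₀ : K, ∀ x : F, v (a - x) < v (a - algebraMap K F c₀) →
      v (aeval x f - aeval a f) < v (aeval a f) := by
  obtain ⟨c₀, h⟩ := prod_sub_approx v a (f.aroots F) hs
  refine ⟨c₀, fun x hx => ?_⟩
  have hsp : (f.map (algebraMap K F)).Splits := IsAlgClosed.splits _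
  rw [hsp.aeval_eq_prod_aroots, hsp.aeval_eq_prod_aroots, ← mul_sub, map_mul, map_mul]
  refine mul_lt_mul_of_pos_left (h x hx) ?_
  rw [Valuation.pos_iff]
  simpa using hf

/-- If all elements of degree less than that of `α` stay away from `a`, and `α` does not, then the
roots of `minpoly K α` are all close to `a`. -/
theorem isCloserThanBase_of_mem_aroots_minpoly {p : ℕ} (hp : p.Prime) [CharP F p]
    (v : Valuation F Γ) {a : F} (hmin : HasNoBestApprox K v a)
    {k : K} (hk : algebraMap K F k = a ^ p) {α : F} (hα : IsCloserThanBase K v a α)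
    (hint : IsIntegral K α) (hdeg : (minpoly K α).natDegree < p) (hne : α ≠ a)
    (hlow : ∀ β : F, (minpoly K β).natDegree < (minpoly K α).natDegree →
      ¬ IsCloserThanBase K v a β) :
    ∀ β ∈ (minpoly K α).aroots F, IsCloserThanBase K v a β := by
  classical
  have : Fact p.Prime := ⟨hp⟩
  set q := minpoly K α with hq
  have hqm : q.Monic := minpoly.monic hint
  have hq1 : q ≠ 1 := minpoly.ne_one K α
  set g : K[X] := X ^ p - C k with hg
  have hgm : g.Monic := monic_X_pow_sub_C k hp.ne_zero
  set r := g %ₘ q with hr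
  have hrdeg : r.natDegree < q.natDegree := natDegree_modByMonic_lt _ hqm hq1
  have hgx : ∀ x : F, aeval x g = (x - a) ^ p := fun x => by
    simp [hg, hk, sub_pow_char]
  have hrα : aeval α r = (α - a) ^ p := by
    rw [← hgx, hr, aeval_modByMonic_eq_self_of_root (minpoly.aeval K α)]
  have hr0 : r ≠ 0 := by
    intro h
    rw [h, map_zero] at hrα
    exact pow_ne_zero p (sub_ne_zero.mpr hne) hrα.symm
  obtain ⟨c₀, h₀⟩ := aeval_approx v a r hr0 fun β hβ =>
    hlow β ((natDegree_minpoly_le_of_mem_aroots hβ).trans_lt hrdeg)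
  set Q := g - r with hQ
  have hgdeg : g.natDegree = p := natDegree_X_pow_sub_C
  have hdegrg : r.degree < g.degree :=
    degree_lt_degree (by rw [hgdeg]; exact hrdeg.trans hdeg)
  have hQm : Q.Monic := hgm.sub_of_left hdegrg
  have hQdeg : Q.natDegree = p := by
    rw [hQ, natDegree_sub_eq_left_of_natDegree_lt (by rw [hgdeg]; exact hrdeg.trans hdeg), hgdeg]
  have hqQ : q ∣ Q := by
    refine ⟨g /ₘ q, ?_⟩
    rw [hQ, sub_eq_iff_eq_add, add_comm]
    exact (modByMonic_add_div g q).symm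
  have hrv : ∀ x : F, v (a - x) < v (a - algebraMap K F c₀) → v (aeval x r) = v (aeval a r) :=
    fun x hx => v.map_eq_of_sub_lt (h₀ x hx)
  have hQv : ∀ c : K, v (a - algebraMap K F c) < v (a - algebraMap K F c₀) →
      v (aeval (algebraMap K F c) Q) = v (a - algebraMap K F c) ^ p := fun c hc => by
    have h1 : v (aeval (algebraMap K F c) r) = v (a - α) ^ p := by
      rw [hrv _ hc, ← hrv α (hα c₀), hrα, map_pow, v.map_sub_swap]
    have h2 : v (aeval (algebraMap K F c) g) = v (a - algebraMap K F c) ^ p := by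
      rw [hgx, map_pow, v.map_sub_swap]
    rw [hQ, map_sub, v.map_sub_eq_of_lt_left, h2]
    rw [h1, h2]
    exact pow_lt_pow_left₀ (hα c) zero_le hp.ne_zero
  have hsp : (Q.map (algebraMap K F)).Splits := IsAlgClosed.splits _
  set S := Q.aroots F with hS
  set S₁ := S.filter (IsCloserThanBase K v a) with hS₁
  set S₂ := S.filter (fun β => ¬ IsCloserThanBase K v a β) with hS₂
  have hSS : S₁ + S₂ = S := Multiset.filter_add_not _ _
  have hcard : Multiset.card S₁ + Multiset.card S₂ = p := by
    rw [← Multiset.card_add, hSS, hS, aroots, ← hsp.natDegree_eq_card_roots, natDegree_map, hQdeg]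
  obtain ⟨c₁, h₁⟩ := prod_sub_approx v a S₂ fun β hβ => (Multiset.mem_filter.mp hβ).2
  set G := v ((S₂.map (a - ·)).prod) with hG
  have hprod : ∀ c : K, v (a - algebraMap K F c) < v (a - algebraMap K F c₁) →
      v (aeval (algebraMap K F c) Q) = v (a - algebraMap K F c) ^ (Multiset.card S₁) * G :=
    fun c hc => by
      rw [hsp.aeval_eq_prod_aroots_of_monic hQm, ← hS, ← hSS, Multiset.map_add,
        Multiset.prod_add, map_mul]
      congr 1
      · rw [map_multiset_prod, Multiset.map_map, ← Multiset.prod_replicate]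
        congr 1
        rw [Multiset.eq_replicate]
        refine ⟨by simp, fun b hb => ?_⟩
        obtain ⟨β, hβ, rfl⟩ := Multiset.mem_map.mp hb
        have hlt := (Multiset.mem_filter.mp hβ).2 c
        rw [Function.comp_apply, v.map_sub_swap, ← v.map_sub_eq_of_lt_right hlt]
        rw [sub_sub_sub_cancel_left, v.map_sub_swap]
      · exact v.map_eq_of_sub_lt (h₁ _ hc)
  have hpos : ∀ c : K, 0 < v (a - algebraMap K F c) := fun c => zero_le.trans_lt (hα c)
  have hG' : ∀ c : K, v (a - algebraMap K F c) < v (a - algebraMap K F c₀) →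
      v (a - algebraMap K F c) < v (a - algebraMap K F c₁) →
      v (a - algebraMap K F c) ^ (Multiset.card S₂) = G := fun c h h' => by
    have := (hQv c h).symm.trans (hprod c h')
    rw [← hcard, pow_add] at this
    exact mul_left_cancel₀ (pow_ne_zero _ (hpos c).ne') this
  obtain ⟨c₂, h20, h21⟩ : ∃ c : K, v (a - algebraMap K F c) < v (a - algebraMap K F c₀) ∧
      v (a - algebraMap K F c) < v (a - algebraMap K F c₁) := by
    obtain ⟨d₀, hd₀⟩ := hmin c₀
    obtain ⟨d₁, hd₁⟩ := hmin c₁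
    rcases le_total (v (a - algebraMap K F d₀)) (v (a - algebraMap K F d₁)) with h | h
    · exact ⟨d₀, hd₀, h.trans_lt hd₁⟩
    · exact ⟨d₁, h.trans_lt hd₀, hd₁⟩
  obtain ⟨c₃, h3⟩ := hmin c₂
  have hzero : Multiset.card S₂ = 0 := by
    by_contra hne0
    have := pow_lt_pow_left₀ h3 zero_le hne0
    rw [hG' c₂ h20 h21, hG' c₃ (h3.trans h20) (h3.trans h21)] at this
    exact lt_irrefl _ this
  intro β hβ
  have hβS : β ∈ S := by
    rw [hS, mem_aroots]
    exact ⟨hQm.ne_zero, aeval_eq_zero_of_dvd_aeval_eq_zero hqQ (mem_aroots.mp hβ).2⟩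
  by_contra hβc
  have : β ∈ S₂ := Multiset.mem_filter.mpr ⟨hβS, hβc⟩
  rw [Multiset.card_eq_zero.mp hzero] at this
  exact Multiset.notMem_zero _ this

/-- The mean of the roots of `minpoly K β` lies in `K`, so they are not all close to `a`. -/
theorem exists_mem_aroots_minpoly_not_isCloserThanBase {p : ℕ} (hp : p.Prime) [CharP F p]
    (v : Valuation F Γ) {a : F} (ha : a ∉ (algebraMap K F).range) {β : F}
    (hβint : IsIntegral K β) (hβ : (minpoly K β).natDegree < p) :
    ∃ γ ∈ (minpoly K β).aroots F, ¬ IsCloserThanBase K v a γ := by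
  by_contra! hγ
  set q := minpoly K β with hq
  have hqm : q.Monic := minpoly.monic hβint
  have hsp : (q.map (algebraMap K F)).Splits := IsAlgClosed.splits _
  set n := q.natDegree with hn
  have hn0 : 0 < n := minpoly.natDegree_pos hβint
  have hcard : Multiset.card (q.aroots F) = n := by
    rw [aroots, ← hsp.natDegree_eq_card_roots, natDegree_map]
  have hvn : v (n : F) = 1 := valuation_natCast_eq_one hp v hn0 hβ
  have hn0' : (n : F) ≠ 0 := by
    rw [← v.ne_zero_iff, hvn]
    exact one_ne_zero
  set c : K := -q.nextCoeff / n with hc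
  have hsum : (n : F) * algebraMap K F c = (q.aroots F).sum := by
    have h1 := hsp.nextCoeff_eq_neg_sum_roots_of_monic (hqm.map _)
    rw [nextCoeff_map (algebraMap K F).injective] at h1
    rw [hc, map_div₀, map_neg, h1, neg_neg, map_natCast, mul_div_cancel₀ _ hn0', aroots]
  have hsum' : (n : F) * (a - algebraMap K F c) = ((q.aroots F).map (a - ·)).sum := by
    rw [mul_sub, hsum, Multiset.sum_map_sub, Multiset.map_const', Multiset.sum_replicate, hcard,
      Multiset.map_id', nsmul_eq_mul]
  have hpos : 0 < v (a - algebraMap K F c) := by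
    rw [Valuation.pos_iff, sub_ne_zero]
    exact fun h => ha ⟨c, h.symm⟩
  have hlt' : ∀ s : Multiset F, (∀ γ ∈ s, IsCloserThanBase K v a γ) →
      v ((s.map (a - ·)).sum) < v (a - algebraMap K F c) := fun s => by
    induction s using Multiset.induction with
    | empty => intro _; simpa using hpos
    | cons γ s ih =>
      intro hs
      rw [Multiset.map_cons, Multiset.sum_cons]
      exact v.map_add_lt (hs γ (Multiset.mem_cons_self _ _) c)
        (ih fun δ hδ => hs δ (Multiset.mem_cons_of_mem hδ))
  have := hlt' _ hγ
  rw [← hsum', map_mul, hvn, one_mul] at this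
  exact lt_irrefl _ this

theorem le_natDegree_minpoly_of_isCloserThanBase {p : ℕ} (hp : p.Prime) [CharP F p]
    [Algebra.IsAlgebraic K F] (v : Valuation F Γ) {a : F} (hmin : HasNoBestApprox K v a)
    {k : K} (hk : algebraMap K F k = a ^ p) (ha : a ∉ (algebraMap K F).range) :
    ∀ α : F, IsCloserThanBase K v a α → p ≤ (minpoly K α).natDegree := by
  by_contra! hex
  have hex' : ∃ n, ∃ α : F, IsCloserThanBase K v a α ∧ (minpoly K α).natDegree = n ∧ n < p := by
    obtain ⟨α, h, h'⟩ := hex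
    exact ⟨_, α, h, rfl, h'⟩
  classical
  obtain ⟨α, hα, hdeg, hlt⟩ := Nat.find_spec hex'
  have hlow : ∀ β : F, (minpoly K β).natDegree < (minpoly K α).natDegree →
      ¬ IsCloserThanBase K v a β := fun β hβ hc =>
    Nat.find_min hex' (hdeg ▸ hβ) ⟨β, hc, rfl, hβ.trans (hdeg ▸ hlt)⟩
  rw [← hdeg] at hlt
  have hint : IsIntegral K α := Algebra.IsIntegral.isIntegral α
  have : Fact p.Prime := ⟨hp⟩
  obtain ⟨γ, hγ, hγc⟩ := exists_mem_aroots_minpoly_not_isCloserThanBase hp v ha hint hlt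
  by_cases hne : α = a
  · rw [hne] at hγ hα
    have hdvd : minpoly K a ∣ X ^ p - C k := minpoly.dvd K a (by simp [hk])
    have hγk := aeval_eq_zero_of_dvd_aeval_eq_zero hdvd (mem_aroots.mp hγ).2
    have hγa : (γ - a) ^ p = 0 := by simpa [hk, sub_pow_char] using hγk
    rw [sub_eq_zero.mp (eq_zero_of_pow_eq_zero hγa)] at hγc
    exact hγc hα
  · exact hγc
      (isCloserThanBase_of_mem_aroots_minpoly hp v hmin hk hα hint hlt hne hlow γ hγ)

theorem aeval_approx_of_isCloserThanBase {p : ℕ} (hp : p.Prime) [CharP F p]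
    [Algebra.IsAlgebraic K F] (v : Valuation F Γ) {a : F} (hmin : HasNoBestApprox K v a)
    {k : K} (hk : algebraMap K F k = a ^ p) (ha : a ∉ (algebraMap K F).range)
    {x : F} (hx : IsCloserThanBase K v a x) {f : K[X]} (hf : f ≠ 0) (hfp : f.natDegree < p) :
    ∃ c₀ : K, ∀ c : K, v (a - algebraMap K F c) < v (a - algebraMap K F c₀) →
      v (aeval x f - algebraMap K F (f.eval c)) < v (aeval x f) := by
  obtain ⟨c₀, h₀⟩ := aeval_approx v a f hf fun β hβ hc =>
    ((natDegree_minpoly_le_of_mem_aroots hβ).trans_lt hfp).not_ge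
      (le_natDegree_minpoly_of_isCloserThanBase hp v hmin hk ha β hc)
  refine ⟨c₀, fun c hc => ?_⟩
  have h1 := h₀ x (hx c₀)
  have h2 := h₀ _ hc
  rw [← aeval_algebraMap_apply_eq_algebraMap_eval, v.map_eq_of_sub_lt h1]
  have := v.map_sub_lt h1 h2
  rwa [sub_sub_sub_cancel_right] at this

end ImmediateApproximation

section ValuationSubringComap

open Polynomial

theorem isEquiv_comap_valuation_s14 {E F : Type*} [Field E] [Field F] (B : ValuationSubring F)
    (f : E →+* F) : (B.comap f).valuation.IsEquiv (B.valuation.comap f) := by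
  rw [Valuation.isEquiv_iff_valuationSubring, ValuationSubring.valuationSubring_valuation]
  ext x
  rw [ValuationSubring.mem_comap, Valuation.mem_valuationSubring_iff, Valuation.comap_apply,
    ValuationSubring.valuation_le_one_iff]

theorem valuation_lt_iff_of_comap_eq {E F : Type*} [Field E] [Field F] {B B' : ValuationSubring F}
    (f : E →+* F) (h : B.comap f = B'.comap f) (x y : E) :
    B.valuation (f x) < B.valuation (f y) ↔ B'.valuation (f x) < B'.valuation (f y) := by
  have h1 := (isEquiv_comap_valuation_s14 B f).lt_iff_lt (x := x) (y := y)
  have h2 := (isEquiv_comap_valuation_s14 B' f).lt_iff_lt (x := x) (y := y)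
  rw [h] at h1
  exact h1.symm.trans h2

theorem isImmediate_comap_iff {K F : Type*} [Field K] [Field F] [Algebra K F]
    (B : ValuationSubring F) (E : IntermediateField K F) :
    IsImmediate K (B.comap (algebraMap E F)) ↔
      (∀ x ∈ E, x ≠ 0 → ∃ c : K, B.valuation x = B.valuation (algebraMap K F c)) ∧
      ∀ x ∈ E, B.valuation x ≤ 1 → ∃ c : K, B.valuation (x - algebraMap K F c) < 1 := by
  have he := isEquiv_comap_valuation_s14 B (algebraMap E F)
  rw [IsImmediate]
  refine and_congr ?_ ?_
  · simp only [he.eq_iff, Subtype.forall, Valuation.comap_apply]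
    simp [Subtype.ext_iff, IntermediateField.algebraMap_apply]
  · simp only [he.le_one_iff_le_one, he.lt_one_iff_lt_one, Subtype.forall, Valuation.comap_apply]
    simp [IntermediateField.algebraMap_apply]

theorem hasNoBestApprox_of_isImmediate {K F : Type*} [Field K] [Field F] [Algebra K F]
    (B : ValuationSubring F) {x : F} (hx : x ∉ (algebraMap K F).range)
    (h : IsImmediate K (B.comap (algebraMap (IntermediateField.adjoin K {x}) F))) :
    HasNoBestApprox K B.valuation x := by
  rw [isImmediate_comap_iff] at h
  intro c
  set E := IntermediateField.adjoin K {x}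
  have hmem : x - algebraMap K F c ∈ E :=
    sub_mem (IntermediateField.mem_adjoin_simple_self K x) (E.algebraMap_mem c)
  have hne : x - algebraMap K F c ≠ 0 := sub_ne_zero.mpr fun e => hx ⟨c, e.symm⟩
  obtain ⟨d, hd⟩ := h.1 _ hmem hne
  have hpos : 0 < B.valuation (algebraMap K F d) := by
    rw [← hd]
    exact B.valuation.pos_iff.mpr hne
  have hd0 : algebraMap K F d ≠ 0 := B.valuation.pos_iff.mp hpos
  obtain ⟨e, he⟩ := h.2 _ (div_mem hmem (E.algebraMap_mem d))
    (by rw [map_div₀, hd, div_self hpos.ne'])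
  refine ⟨c + d * e, ?_⟩
  have heq : x - algebraMap K F (c + d * e) =
      algebraMap K F d * ((x - algebraMap K F c) / algebraMap K F d - algebraMap K F e) := by
    rw [map_add, map_mul]
    field_simp
    ring
  rw [heq, map_mul, hd]
  exact mul_lt_of_lt_one_right hpos he

theorem exists_valuationSubring_comap_eq {E F : Type*} [Field E] [Field F] (f : E →+* F)
    (C : ValuationSubring E) : ∃ B : ValuationSubring F, B.comap f = C := by
  obtain ⟨B, hB⟩ := (LocalSubring.map f C.toLocalSubring).exists_le_valuationSubring
  refine ⟨B, ?_⟩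
  have hle : ∀ x ∈ C, f x ∈ B := fun x hx => hB.1 ⟨x, hx, rfl⟩
  ext x
  rw [ValuationSubring.mem_comap]
  refine ⟨fun hx => ?_, hle x⟩
  rcases C.mem_or_inv_mem x with hC | hC
  · exact hC
  rcases eq_or_ne x 0 with rfl | hx0
  · exact C.zero_mem
  have hu : IsUnit (Subring.inclusion hB.1 ⟨f x⁻¹, x⁻¹, hC, rfl⟩) :=
    isUnit_iff_exists_inv.mpr ⟨⟨f x, hx⟩, Subtype.ext (by
      change f x⁻¹ * f x = 1
      rw [← map_mul, inv_mul_cancel₀ hx0, map_one])⟩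
  obtain ⟨⟨_, y, hy, rfl⟩, hy'⟩ := isUnit_iff_exists_inv.mp (hB.2.1 _ hu)
  have hy1 : f x⁻¹ * f y = 1 := congrArg Subtype.val hy'
  rw [← map_mul, map_eq_one_iff f f.injective, inv_mul_eq_one₀ hx0] at hy1
  exact hy1 ▸ hy

variable {K F : Type*} [Field K] [Field F] [Algebra K F] {p : ℕ} [CharP F p] {a : F} {k : K}

theorem valuation_sub_lt_iff_of_comap_eq (hp : p.Prime) {B B' : ValuationSubring F}
    (hBB : B.comap (algebraMap K F) = B'.comap (algebraMap K F))
    (hk : algebraMap K F k = a ^ p) (c d : K) :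
    B.valuation (a - algebraMap K F c) < B.valuation (a - algebraMap K F d) ↔
      B'.valuation (a - algebraMap K F c) < B'.valuation (a - algebraMap K F d) := by
  have : Fact p.Prime := ⟨hp⟩
  have e : ∀ (v : ValuationSubring F) (c : K),
      v.valuation (a - algebraMap K F c) ^ p = v.valuation (algebraMap K F (k - c ^ p)) :=
    fun v c => by rw [← map_pow, sub_pow_char, map_sub (algebraMap K F), hk, map_pow (algebraMap K F)]
  rw [← pow_lt_pow_iff_left₀ zero_le zero_le hp.ne_zero, e, e,
    ← pow_lt_pow_iff_left₀ (a := B'.valuation _) zero_le zero_le hp.ne_zero, e, e]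
  exact valuation_lt_iff_of_comap_eq _ hBB _ _

theorem isCloserThanBase_artinSchreier_iff_of_comap_eq (hp : p.Prime) {B B' : ValuationSubring F}
    (hBB : B.comap (algebraMap K F) = B'.comap (algebraMap K F))
    (hk : algebraMap K F k = a ^ p) (ha : a ≠ 0) {θ : F} (hθ : θ ^ p - θ = a ^ p) :
    IsCloserThanBase K B.valuation a θ ↔ IsCloserThanBase K B'.valuation a θ := by
  have : Fact p.Prime := ⟨hp⟩
  rw [isCloserThanBase_artinSchreier_iff hp _ ha hθ, isCloserThanBase_artinSchreier_iff hp _ ha hθ]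
  refine forall_congr' fun c => ?_
  have e : ∀ v : ValuationSubring F, v.valuation a < v.valuation (a - algebraMap K F c) ^ p ↔
      v.valuation (algebraMap K F k) < v.valuation (algebraMap K F ((k - c ^ p) ^ p)) :=
    fun v => by
      rw [← pow_lt_pow_iff_left₀ zero_le zero_le hp.ne_zero, ← map_pow, ← map_pow, ← map_pow,
        sub_pow_char, hk, map_pow (algebraMap K F), map_sub, hk, map_pow (algebraMap K F)]
  rw [e, e]
  exact valuation_lt_iff_of_comap_eq _ hBB _ _

variable [IsAlgClosed F] [Algebra.IsAlgebraic K F]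

theorem isImmediate_adjoin_of_isCloserThanBase (hp : p.Prime) (B : ValuationSubring F)
    (hmin : HasNoBestApprox K B.valuation a) (hk : algebraMap K F k = a ^ p)
    (ha : a ∉ (algebraMap K F).range) {x : F} (hx : IsCloserThanBase K B.valuation a x)
    (hdeg : (minpoly K x).natDegree ≤ p) :
    IsImmediate K (B.comap (algebraMap (IntermediateField.adjoin K {x}) F)) := by
  rw [isImmediate_comap_iff]
  have key : ∀ y ∈ IntermediateField.adjoin K {x}, y ≠ 0 →
      ∃ c : K, B.valuation (y - algebraMap K F c) < B.valuation y := fun y hy hy0 => by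
    obtain ⟨f, hf, rfl⟩ := exists_aeval_eq_of_mem_adjoin
      (Algebra.IsIntegral.isIntegral (R := K) x) hdeg hy
    obtain ⟨c₀, h₀⟩ := aeval_approx_of_isCloserThanBase hp B.valuation hmin hk ha hx
      (f := f) (by rintro rfl; simp at hy0) hf
    obtain ⟨c, hc⟩ := hmin c₀
    exact ⟨f.eval c, h₀ c hc⟩
  constructor
  · intro y hy hy0
    obtain ⟨c, hc⟩ := key y hy hy0
    refine ⟨c, (B.valuation.map_eq_of_sub_lt ?_).symm⟩
    rwa [B.valuation.map_sub_swap]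
  · intro y hy hy1
    rcases eq_or_ne y 0 with rfl | hy0
    · exact ⟨0, by simp⟩
    · obtain ⟨c, hc⟩ := key y hy hy0
      exact ⟨c, hc.trans_le hy1⟩

/-- All extensions of the valuation of `K` agree on `K(x)` when `x` is close to `a` in each. -/
theorem mem_iff_mem_of_isCloserThanBase (hp : p.Prime) {B B' : ValuationSubring F}
    (hBB : B.comap (algebraMap K F) = B'.comap (algebraMap K F))
    (hmin : HasNoBestApprox K B.valuation a) (hk : algebraMap K F k = a ^ p)
    (ha : a ∉ (algebraMap K F).range) {x y : F} (hx : IsCloserThanBase K B.valuation a x)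
    (hx' : IsCloserThanBase K B'.valuation a x) (hdeg : (minpoly K x).natDegree ≤ p)
    (hy : y ∈ IntermediateField.adjoin K {x}) : y ∈ B ↔ y ∈ B' := by
  rcases eq_or_ne y 0 with rfl | hy0
  · simp
  have hiff := valuation_sub_lt_iff_of_comap_eq hp hBB hk
  have hmin' : HasNoBestApprox K B'.valuation a := fun c =>
    (hmin c).imp fun d hd => (hiff d c).mp hd
  obtain ⟨f, hf, rfl⟩ := exists_aeval_eq_of_mem_adjoin
    (Algebra.IsIntegral.isIntegral (R := K) x) hdeg hy
  have hf0 : f ≠ 0 := by rintro rfl; simp at hy0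
  obtain ⟨c₁, h₁⟩ := aeval_approx_of_isCloserThanBase hp B.valuation hmin hk ha hx hf0 hf
  obtain ⟨c₂, h₂⟩ := aeval_approx_of_isCloserThanBase hp B'.valuation hmin' hk ha hx' hf0 hf
  obtain ⟨c, hc₁, hc₂⟩ : ∃ c : K,
      B.valuation (a - algebraMap K F c) < B.valuation (a - algebraMap K F c₁) ∧
      B.valuation (a - algebraMap K F c) < B.valuation (a - algebraMap K F c₂) := by
    obtain ⟨d₁, hd₁⟩ := hmin c₁
    obtain ⟨d₂, hd₂⟩ := hmin c₂
    rcases le_total (B.valuation (a - algebraMap K F d₁)) (B.valuation (a - algebraMap K F d₂))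
      with h | h
    · exact ⟨d₁, hd₁, h.trans_lt hd₂⟩
    · exact ⟨d₂, h.trans_lt hd₁, hd₂⟩
  have e₁ := B.valuation.map_eq_of_sub_lt (B.valuation.map_sub_swap _ _ ▸ h₁ c hc₁)
  have e₂ := B'.valuation.map_eq_of_sub_lt (B'.valuation.map_sub_swap _ _ ▸ h₂ c ((hiff _ _).mp hc₂))
  rw [← B.valuation_le_one_iff, ← B'.valuation_le_one_iff, ← e₁, ← e₂, B.valuation_le_one_iff,
    B'.valuation_le_one_iff, ← ValuationSubring.mem_comap, hBB, ValuationSubring.mem_comap]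

end ValuationSubringComap

/-- Deformation of an immediate purely inseparable extension (not lying in the completion) into
a dependent Artin-Schreier defect extension. -/
theorem statement14 {K : Type u} [Field K] (p : ℕ) (hp : 0 < p) [CharP K p]
    (A : ValuationSubring K) (B : ValuationSubring (AlgebraicClosure K))
    (hB : B.comap (algebraMap K (AlgebraicClosure K)) = A)
    (η : AlgebraicClosure K)
    (hηp : η ^ p ∈ (algebraMap K (AlgebraicClosure K)).range)
    (hη : η ∉ (algebraMap K (AlgebraicClosure K)).range)
    (himm : IsImmediate K
      (B.comap (algebraMap (IntermediateField.adjoin K {η} : IntermediateField K (AlgebraicClosure K))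
        (AlgebraicClosure K))))
    (hnc : ∃ d : K, d ≠ 0 ∧ ∀ c : K,
      B.valuation (algebraMap K (AlgebraicClosure K) d) <
        B.valuation (η - algebraMap K (AlgebraicClosure K) c))
    (b : K) (hb : b ≠ 0) :
    ((∀ c : K,
        B.valuation (algebraMap K (AlgebraicClosure K) b) ^ (p - 1) * B.valuation η <
          B.valuation (η - algebraMap K (AlgebraicClosure K) c) ^ p) ↔
      (∃ θ : AlgebraicClosure K,
        θ ^ p - θ = (η / algebraMap K (AlgebraicClosure K) b) ^ p ∧
        ∀ c : K,
          B.valuation (θ - η / algebraMap K (AlgebraicClosure K) b) <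
            B.valuation (η / algebraMap K (AlgebraicClosure K) b -
              algebraMap K (AlgebraicClosure K) c))) ∧
    (∀ θ : AlgebraicClosure K,
        θ ^ p - θ = (η / algebraMap K (AlgebraicClosure K) b) ^ p →
        (∀ c : K,
          B.valuation (θ - η / algebraMap K (AlgebraicClosure K) b) <
            B.valuation (η / algebraMap K (AlgebraicClosure K) b -
              algebraMap K (AlgebraicClosure K) c)) →
        B.valuation θ * B.valuation (algebraMap K (AlgebraicClosure K) b) = B.valuation η ∧
        θ ∉ (algebraMap K (AlgebraicClosure K)).range ∧
        (∀ C C' : ValuationSubring (IntermediateField.adjoin K {θ} : IntermediateField K (AlgebraicClosure K)),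
          C.comap (algebraMap K (IntermediateField.adjoin K {θ} : IntermediateField K (AlgebraicClosure K))) = A →
          C'.comap (algebraMap K (IntermediateField.adjoin K {θ} : IntermediateField K (AlgebraicClosure K))) = A →
          C = C') ∧
        IsImmediate K
          (B.comap (algebraMap (IntermediateField.adjoin K {θ} : IntermediateField K (AlgebraicClosure K))
            (AlgebraicClosure K))) ∧
        ∃ η' : AlgebraicClosure K,
          η' ^ p ∈ (algebraMap K (AlgebraicClosure K)).range ∧
          η' ∉ (algebraMap K (AlgebraicClosure K)).range ∧
          IsImmediate K
            (B.comap (algebraMap (IntermediateField.adjoin K {η'} : IntermediateField K (AlgebraicClosure K))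
              (AlgebraicClosure K))) ∧
          ∀ c : K, B.valuation (θ - η') <
            B.valuation (θ - algebraMap K (AlgebraicClosure K) c)) := by
  have hprime : p.Prime := (CharP.char_is_prime_or_zero K p).resolve_right hp.ne'
  have hfact : Fact p.Prime := ⟨hprime⟩
  have hchar : CharP (AlgebraicClosure K) p :=
    charP_of_injective_algebraMap (algebraMap K (AlgebraicClosure K)).injective p
  set ι := algebraMap K (AlgebraicClosure K) with hι
  set a := η / ι b with haη
  have hb' : ι b ≠ 0 := (map_ne_zero ι).mpr hb
  have hvb : 0 < B.valuation (ι b) := B.valuation.pos_iff.mpr hb'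
  have hηa : η = a * ι b := (div_mul_cancel₀ η hb').symm
  have ha : a ∉ ι.range := by
    rintro ⟨c, hc⟩
    exact hη ⟨c * b, by rw [map_mul, hc, hηa]⟩
  have ha0 : a ≠ 0 := fun h => ha ⟨0, by rw [map_zero, h]⟩
  obtain ⟨k, hk⟩ : ∃ k, ι k = a ^ p := by
    obtain ⟨l, hl⟩ := hηp
    exact ⟨l / b ^ p, by rw [map_div₀, hl, map_pow, haη, div_pow]⟩
  have hsub : ∀ c, η - ι (c * b) = (a - ι c) * ι b := fun c => by
    rw [map_mul, sub_mul, ← hηa]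
  have hmin : HasNoBestApprox K B.valuation a := fun c => by
    obtain ⟨c', hc'⟩ := hasNoBestApprox_of_isImmediate B hη himm (c * b)
    refine ⟨c' / b, lt_of_mul_lt_mul_right (a := B.valuation (ι b)) ?_ zero_le⟩
    rwa [← map_mul, ← map_mul, ← hsub, ← hsub, div_mul_cancel₀ _ hb]
  have hclose : ∀ θ, IsCloserThanBase K B.valuation a θ ↔
      ∀ c : K, B.valuation (θ - a) < B.valuation (a - ι c) := fun θ =>
    forall_congr' fun c => by rw [B.valuation.map_sub_swap a θ]
  have hcond : (∀ c : K, B.valuation (ι b) ^ (p - 1) * B.valuation η <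
      B.valuation (η - ι c) ^ p) ↔ ∀ c : K, B.valuation a < B.valuation (a - ι c) ^ p := by
    have key : ∀ c : K, B.valuation (ι b) ^ (p - 1) * B.valuation η <
        B.valuation (η - ι (c * b)) ^ p ↔ B.valuation a < B.valuation (a - ι c) ^ p := fun c => by
      have e : B.valuation (ι b) ^ (p - 1) * B.valuation η =
          B.valuation a * B.valuation (ι b) ^ p := by
        rw [← mul_pow_sub_one hp.ne' (B.valuation (ι b)), hηa, map_mul, mul_comm, mul_assoc]
      rw [hsub, map_mul, mul_pow, e, mul_lt_mul_iff_left₀ (pow_pos hvb p)]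
    refine ⟨fun h c => (key c).mp (h _), fun h c => ?_⟩
    rw [← div_mul_cancel₀ c hb]
    exact (key _).mpr (h _)
  have hminpoly : ∀ {x : AlgebraicClosure K} {f : Polynomial K}, f ≠ 0 → f.natDegree = p →
      Polynomial.aeval x f = 0 → (minpoly K x).natDegree ≤ p := fun hf hfd hx =>
    hfd ▸ natDegree_minpoly_le_of_mem_aroots (Polynomial.mem_aroots.mpr ⟨hf, hx⟩)
  refine ⟨?_, fun θ hθ hθc => ?_⟩
  · rw [hcond]
    constructor
    · intro h
      obtain ⟨θ, hθ⟩ := IsAlgClosed.exists_root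
        (Polynomial.X ^ p - Polynomial.X - Polynomial.C (a ^ p))
        (by
          rw [sub_sub, Polynomial.degree_sub_eq_left_of_degree_lt] <;>
            rw [Polynomial.degree_X_pow]
          · exact_mod_cast hp.ne'
          · rw [Polynomial.degree_X_add_C]
            exact_mod_cast hprime.one_lt)
      have hθ' : θ ^ p - θ = a ^ p := by
        rw [← sub_eq_zero]
        simpa using hθ
      exact ⟨θ, hθ', (hclose θ).mp
        ((isCloserThanBase_artinSchreier_iff hprime _ ha0 hθ').mpr h)⟩
    · rintro ⟨θ, hθ, hθc⟩
      exact (isCloserThanBase_artinSchreier_iff hprime _ ha0 hθ).mp ((hclose θ).mpr hθc)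
  · have hθcl := (hclose θ).mpr hθc
    have hθdeg : (minpoly K θ).natDegree ≤ p := by
      have hlt : (Polynomial.X + Polynomial.C k).natDegree <
          (Polynomial.X ^ p : Polynomial K).natDegree := by
        rw [Polynomial.natDegree_X_add_C, Polynomial.natDegree_X_pow]
        exact hprime.one_lt
      have hd : (Polynomial.X ^ p - (Polynomial.X + Polynomial.C k)).natDegree = p := by
        rw [Polynomial.natDegree_sub_eq_left_of_natDegree_lt hlt, Polynomial.natDegree_X_pow]
      refine hminpoly (fun h => ?_) hd ?_
      · rw [h, Polynomial.natDegree_zero] at hd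
        exact hp.ne hd
      · rw [map_sub, map_add, map_pow, Polynomial.aeval_X, Polynomial.aeval_C, ← hι, hk, ← hθ]
        ring
    have hadeg : (minpoly K a).natDegree ≤ p :=
      hminpoly (Polynomial.X_pow_sub_C_ne_zero hp k) Polynomial.natDegree_X_pow_sub_C
        (by rw [map_sub, map_pow, Polynomial.aeval_X, Polynomial.aeval_C, ← hι, hk, sub_self])
    refine ⟨?_, ?_, fun C C' hC hC' => ?_, ?_, a, ⟨k, hk⟩, ha, ?_, fun c => ?_⟩
    · have h0 := hθc 0
      rw [map_zero, sub_zero] at h0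
      rw [B.valuation.map_eq_of_sub_lt h0, ← map_mul, ← hηa]
    · rintro ⟨c, rfl⟩
      exact lt_irrefl _ (hθcl c)
    · have huniq : ∀ C : ValuationSubring (IntermediateField.adjoin K {θ}),
          C.comap (algebraMap K (IntermediateField.adjoin K {θ})) = A →
          ∀ x, x ∈ C ↔ (x : AlgebraicClosure K) ∈ B := fun C hC x => by
        obtain ⟨B', hB'⟩ := exists_valuationSubring_comap_eq
          (algebraMap (IntermediateField.adjoin K {θ}) (AlgebraicClosure K)) C
        have hBB : B.comap (algebraMap K (AlgebraicClosure K)) =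
            B'.comap (algebraMap K (AlgebraicClosure K)) := by
          rw [hB, ← hC, ← hB', ValuationSubring.comap_comap, ← IsScalarTower.algebraMap_eq]
        rw [mem_iff_mem_of_isCloserThanBase hprime hBB hmin hk ha hθcl
          ((isCloserThanBase_artinSchreier_iff_of_comap_eq hprime hBB hk ha0 hθ).mp hθcl) hθdeg x.2,
          ← hB']
        exact ValuationSubring.mem_comap
      ext x
      rw [huniq C hC, huniq C' hC']
    · exact isImmediate_adjoin_of_isCloserThanBase hprime B hmin hk ha hθcl hθdeg
    · refine isImmediate_adjoin_of_isCloserThanBase hprime B hmin hk ha (fun c => ?_) hadeg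
      rw [sub_self, map_zero]
      exact zero_le.trans_lt (hθcl c)
    · have h := hθc c
      rwa [← B.valuation.map_add_eq_of_lt_right h, sub_add_sub_cancel] at h

end ValuedDefect
end
end
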